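/- arXiv:0810.5684 — 2 statements merged into one kernel-verified Lean document; each statement's English description precedes it below -/
import Mathlib

section
/- A ring R is right pure semisimple (i.e., every pure monomorphism between right R-modules splits) if and only if the category Mod-R of all right R-modules is pure semisimple as an additive category, i.e., there exists a right R-module X such that Mod-R = Add X. -/
/-!
Statement 0: A ring `R` is right pure semisimple (every pure monomorphism between right
`R`-modules splits) if and only if the category `Mod-R` of all right `R`-modules is pure
semisimple as an additive category, i.e. there exists a right `R`-module `X` such that
`Mod-R = Add X` (every right `R`-module is a direct summand of a coproduct of copies of `X`).

Right `R`-modules are formalized as left `Rᵐᵒᵖ`-modules; a monomorphism `f : M → N` is pure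
iff for every finitely presented module `P` every morphism `P → N / im f` lifts to `N`
(the standard characterization of purity of the short exact sequence
`0 → M → N → N/im f → 0`).
-/

open CategoryTheory CategoryTheory.Limits

universe u

/-- `f` is a pure monomorphism of right `R`-modules: it is injective, and every homomorphism
from a finitely presented module to its cokernel lifts along the projection. -/
def IsPureMono (R : Type u) [Ring R] {M N : Type u} [AddCommGroup M] [AddCommGroup N]
    [Module Rᵐᵒᵖ M] [Module Rᵐᵒᵖ N] (f : M →ₗ[Rᵐᵒᵖ] N) : Prop :=
  Function.Injective f ∧
    ∀ (P : Type u) [AddCommGroup P] [Module Rᵐᵒᵖ P], Module.FinitePresentation Rᵐᵒᵖ P →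
      ∀ h : P →ₗ[Rᵐᵒᵖ] N ⧸ LinearMap.range f,
        ∃ g : P →ₗ[Rᵐᵒᵖ] N, (LinearMap.range f).mkQ.comp g = h

/-- `R` is right pure semisimple: every pure monomorphism between right `R`-modules splits. -/
def IsRightPureSemisimple (R : Type u) [Ring R] : Prop :=
  ∀ (M N : Type u) [AddCommGroup M] [AddCommGroup N] [Module Rᵐᵒᵖ M] [Module Rᵐᵒᵖ N]
    (f : M →ₗ[Rᵐᵒᵖ] N), IsPureMono R f →
      ∃ r : N →ₗ[Rᵐᵒᵖ] M, r.comp f = LinearMap.id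

/-- The additive category `B` is pure semisimple: it has an additive generator `X`, that is,
every object is a direct summand of a coproduct of copies of `X`. -/
def IsPureSemisimpleCat (B : Type*) [Category B] : Prop :=
  ∃ X : B, ∀ Y : B, ∃ (I : Type u) (c : Cofan fun _ : I => X) (_ : IsColimit c)
    (s : Y ⟶ c.pt) (r : c.pt ⟶ Y), s ≫ r = 𝟙 Y

section SolvingEquations

variable {S : Type u} [Ring S] {L M N : Type u} [AddCommGroup L] [Module S L]
  [AddCommGroup M] [Module S M] [AddCommGroup N] [Module S N]

/-- The possible values at `p` of homomorphisms `L → M` which vanish on `K`. -/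
def valueSubgroup (K : Submodule S L) (p : L) (M : Type u) [AddCommGroup M] [Module S M] :
    AddSubgroup M where
  carrier := {x | ∃ h : L →ₗ[S] M, K ≤ LinearMap.ker h ∧ h p = x}
  zero_mem' := ⟨0, by simp, rfl⟩
  add_mem' := by
    rintro _ _ ⟨h, hK, rfl⟩ ⟨h', hK', rfl⟩
    exact ⟨h + h', fun x hx => by simp [LinearMap.mem_ker.1 (hK hx),
      LinearMap.mem_ker.1 (hK' hx)], rfl⟩
  neg_mem' := by
    rintro _ ⟨h, hK, rfl⟩
    exact ⟨-h, fun x hx => by simp [LinearMap.mem_ker.1 (hK hx)], rfl⟩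

theorem mem_valueSubgroup {K : Submodule S L} {p : L} {x : M} :
    x ∈ valueSubgroup K p M ↔ ∃ h : L →ₗ[S] M, K ≤ LinearMap.ker h ∧ h p = x :=
  Iff.rfl

theorem valueSubgroup_anti {K K' : Submodule S L} (hK : K ≤ K') (p : L) :
    valueSubgroup K' p M ≤ valueSubgroup K p M :=
  fun _ ⟨h, hh, hp⟩ => ⟨h, hK.trans hh, hp⟩

theorem map_mem_valueSubgroup {K : Submodule S L} {p : L} (f : M →ₗ[S] N) {x : M}
    (hx : x ∈ valueSubgroup K p M) : f x ∈ valueSubgroup K p N := by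
  obtain ⟨h, hK, rfl⟩ := hx
  exact ⟨f ∘ₗ h, fun x hx => by simp [LinearMap.mem_ker.1 (hK hx)], rfl⟩

theorem pi_mem_valueSubgroup {K : Submodule S L} {p : L} {ι : Type u} {x : ι → M}
    (hx : ∀ i, x i ∈ valueSubgroup K p M) : x ∈ valueSubgroup K p (ι → M) := by
  choose h hK hp using hx
  refine ⟨LinearMap.pi h, fun y hy => ?_, funext hp⟩
  ext i
  exact hK i hy

theorem finsupp_mem_valueSubgroup {K : Submodule S L} {p : L} {ι : Type u} {x : ι →₀ M}
    (hx : ∀ i, x i ∈ valueSubgroup K p M) : x ∈ valueSubgroup K p (ι →₀ M) := by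
  rw [← x.sum_single]
  exact sum_mem fun i _ => map_mem_valueSubgroup (Finsupp.lsingle i) (hx i)

variable (S M) in
/-- Descending sequences of subgroups of values in `M` do not descend strictly forever. -/
def HasValueDCC : Prop :=
  ∀ (L : Type u) [AddCommGroup L] [Module S L] (p : L) (K : ℕ → Submodule S L), Monotone K →
    ∃ n, valueSubgroup (K n) p M ≤ valueSubgroup (K (n + 1)) p M

/-- Every finite subset of the system `T` of equations `h e.1 = e.2` for a homomorphism `h`
has a solution. -/
def IsFinitelySolvable (S : Type u) [Ring S] [Module S L] [Module S M] (T : Set (L × M)) : Prop :=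
  ∀ D ⊆ T, D.Finite → ∃ h : L →ₗ[S] M, ∀ e ∈ D, h e.1 = e.2

theorem HasValueDCC.exists_minimal (hM : HasValueDCC S M) (T : Set (L × M)) (l : L) :
    ∃ D ⊆ T, D.Finite ∧ ∀ D' ⊆ T, D'.Finite → D ⊆ D' →
      valueSubgroup (Submodule.span S (Prod.fst '' D)) l M ≤
        valueSubgroup (Submodule.span S (Prod.fst '' D')) l M := by
  by_contra! H
  let F := {D : Set (L × M) // D ⊆ T ∧ D.Finite}
  have H' : ∀ D : F, ∃ D' : F, D.1 ⊆ D'.1 ∧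
      ¬ valueSubgroup (Submodule.span S (Prod.fst '' D.1)) l M ≤
        valueSubgroup (Submodule.span S (Prod.fst '' D'.1)) l M := by
    rintro ⟨D, hD, hf⟩
    obtain ⟨D', hD', hf', hs, hn⟩ := H D hD hf
    exact ⟨⟨D', hD', hf'⟩, hs, hn⟩
  choose next hs hn using H'
  let D : ℕ → F := fun n => next^[n] ⟨∅, by simp⟩
  have hD : ∀ n, D (n + 1) = next (D n) := fun n => Function.iterate_succ_apply' _ _ _
  have hmono : Monotone fun n => Submodule.span S (Prod.fst '' (D n).1) :=
    monotone_nat_of_le_succ fun n => by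
      rw [hD]
      exact Submodule.span_mono (Set.image_mono (hs _))
  obtain ⟨n, h⟩ := hM L l _ hmono
  rw [hD] at h
  exact hn _ h

theorem IsFinitelySolvable.exists_insert {T : Set (L × M)} (hM : HasValueDCC S M)
    (hT : IsFinitelySolvable S T) (l : L) :
    ∃ a : M, IsFinitelySolvable S (insert (l, a) T) := by
  obtain ⟨D, hDT, hD, hmin⟩ := hM.exists_minimal T l
  obtain ⟨h₀, hh₀⟩ := hT D hDT hD
  refine ⟨h₀ l, fun D₁ hD₁ hf => ?_⟩
  have hsub : D ∪ (D₁ \ {(l, h₀ l)}) ⊆ T := by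
    rintro e (he | ⟨he, hne⟩)
    · exact hDT he
    · exact (hD₁ he).resolve_left hne
  have hfin : (D ∪ (D₁ \ {(l, h₀ l)})).Finite := hD.union (hf.subset Set.sdiff_subset)
  obtain ⟨h₁, hh₁⟩ := hT _ hsub hfin
  obtain ⟨g, hg, hgl⟩ := hmin _ hsub hfin Set.subset_union_left
    (mem_valueSubgroup.2 ⟨h₀ - h₁, Submodule.span_le.2 (by
      rintro _ ⟨e, he, rfl⟩
      simp [hh₀ e he, hh₁ e (Or.inl he)]), rfl⟩)
  refine ⟨h₁ + g, fun e he => ?_⟩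
  by_cases hel : e = (l, h₀ l)
  · subst hel
    simp [hgl]
  · have he' : e ∈ D ∪ (D₁ \ {(l, h₀ l)}) := Or.inr ⟨he, hel⟩
    have : g e.1 = 0 := hg (Submodule.subset_span ⟨e, he', rfl⟩)
    simp [this, hh₁ e he']

/-- Modules with the descending chain condition are algebraically compact. -/
theorem IsFinitelySolvable.exists_solution {T : Set (L × M)} (hM : HasValueDCC S M)
    (hT : IsFinitelySolvable S T) : ∃ h : L →ₗ[S] M, ∀ e ∈ T, h e.1 = e.2 := by
  obtain ⟨T', hTT', hmax⟩ := zorn_subset_nonempty {T : Set (L × M) | IsFinitelySolvable S T}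
    (fun c hc hchain hne => ⟨⋃₀ c, fun D hD hf => by
      obtain ⟨t, ht, hDt⟩ := hchain.directedOn.exists_mem_subset_of_finite_of_subset_sUnion
        hne hf hD
      exact hc ht D hDt hf, fun s hs => Set.subset_sUnion_of_mem hs⟩) T hT
  have hT' : IsFinitelySolvable S T' := hmax.prop
  have htotal : ∀ l, ∃ a, (l, a) ∈ T' := fun l => by
    obtain ⟨a, ha⟩ := hT'.exists_insert hM l
    exact ⟨a, hmax.le_of_ge ha (Set.subset_insert _ _) (Set.mem_insert _ _)⟩
  choose a ha using htotal
  refine ⟨⟨⟨a, fun x y => ?_⟩, fun r x => ?_⟩, fun e he => ?_⟩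
  · obtain ⟨h, hh⟩ := hT' {(x, a x), (y, a y), (x + y, a (x + y))}
      (by rintro _ (rfl | rfl | rfl) <;> exact ha _) (Set.toFinite _)
    simp only [Set.mem_insert_iff, Set.mem_singleton_iff, forall_eq_or_imp, forall_eq] at hh
    rw [← hh.2.2, map_add, hh.1, hh.2.1]
  · obtain ⟨h, hh⟩ := hT' {(x, a x), (r • x, a (r • x))}
      (by rintro _ (rfl | rfl) <;> exact ha _) (Set.toFinite _)
    simp only [Set.mem_insert_iff, Set.mem_singleton_iff, forall_eq_or_imp, forall_eq] at hh
    simp [← hh.2, hh.1]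
  · obtain ⟨h, hh⟩ := hT' {e, (e.1, a e.1)}
      (by rintro _ (rfl | rfl); exacts [hTT' he, ha _]) (Set.toFinite _)
    simp only [Set.mem_insert_iff, Set.mem_singleton_iff, forall_eq_or_imp, forall_eq] at hh
    exact hh.2.symm.trans hh.1

end SolvingEquations

section ChainCondition

variable {S : Type u} [Ring S] {L M X : Type u} [AddCommGroup L] [Module S L]
  [AddCommGroup M] [Module S M] [AddCommGroup X] [Module S X]

/-- `Y` is a direct summand of a direct sum of copies of `X`. -/
def IsSummandOfCopies (S X Y : Type u) [Ring S] [AddCommGroup X] [Module S X]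
    [AddCommGroup Y] [Module S Y] : Prop :=
  ∃ (I : Type u) (s : Y →ₗ[S] I →₀ X) (r : (I →₀ X) →ₗ[S] Y), r ∘ₗ s = LinearMap.id

/-- Chase's lemma for a homomorphism from a countable power to a direct sum. -/
theorem exists_finset_forall_mem_valueSubgroup {I : Type u} {p : L} {K : ℕ → Submodule S L}
    (hK : Monotone K) (s : (ULift.{u} ℕ → M) →ₗ[S] I →₀ X) :
    ∃ (n : ℕ) (J : Finset I), ∀ y ∈ valueSubgroup (K n) p (ULift.{u} ℕ → M),
      (∀ k, k.down < n → y k = 0) → ∀ i ∉ J, s y i ∈ valueSubgroup (K (n + 1)) p X := by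
  classical
  by_contra! H
  choose y hy hy0 i hiJ hi using H
  let J : ℕ → Finset I := fun n =>
    Nat.rec ∅ (fun k Jk => Jk ∪ ((s (y k Jk)).support ∪ {i k Jk})) n
  have hJ : ∀ n, J (n + 1) = J n ∪ ((s (y n (J n))).support ∪ {i n (J n)}) := fun _ => rfl
  have hJmono : Monotone J := monotone_nat_of_le_succ fun n => by
    rw [hJ]
    exact Finset.subset_union_left
  let z : ULift.{u} ℕ → M := fun t => ∑ k ∈ Finset.range (t.down + 1), y k (J k) t
  have key : ∀ k, s z (i k (J k)) ≠ 0 := by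
    intro k hzero
    let w : ULift.{u} ℕ → M :=
      fun t => ∑ j ∈ (Finset.range (t.down + 1)).filter (k < ·), y j (J j) t
    have hw : w ∈ valueSubgroup (K (k + 1)) p (ULift.{u} ℕ → M) :=
      pi_mem_valueSubgroup fun t => sum_mem fun j hj =>
        map_mem_valueSubgroup (LinearMap.proj t)
          (valueSubgroup_anti (hK (Finset.mem_filter.1 hj).2) p (hy j (J j)))
    have hz : z = (∑ j ∈ Finset.range k, y j (J j)) + y k (J k) + w := by
      rw [← Finset.sum_range_succ]
      ext t
      simp only [z, w, Pi.add_apply, Finset.sum_apply]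
      rw [← Finset.sum_filter_add_sum_filter_not (Finset.range (t.down + 1)) (k < ·), add_comm]
      congr 1
      refine Finset.sum_subset_zero_on_sdiff (fun j hj => ?_) (fun j hj => ?_) fun _ _ => rfl
      · simp only [Finset.mem_filter, Finset.mem_range] at hj ⊢
        omega
      · apply hy0
        simp only [Finset.mem_sdiff, Finset.mem_filter, Finset.mem_range] at hj
        omega
    have h0 : s (∑ j ∈ Finset.range k, y j (J j)) (i k (J k)) = 0 := by
      rw [map_sum, Finsupp.finsetSum_apply]
      refine Finset.sum_eq_zero fun j hj => ?_
      by_contra hne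
      have : i k (J k) ∈ J (j + 1) := by
        rw [hJ]
        simp [hne]
      exact hiJ k (J k) (hJmono (Finset.mem_range.1 hj) this)
    rw [hz, map_add, map_add, Finsupp.add_apply, Finsupp.add_apply, h0, zero_add] at hzero
    refine hi k (J k) ?_
    rw [eq_neg_of_add_eq_zero_left hzero]
    exact neg_mem (map_mem_valueSubgroup (Finsupp.lapply _ ∘ₗ s) hw)
  have hinj : Function.Injective fun k => i k (J k) :=
    Function.Injective.of_lt_imp_ne fun j k hjk heq => by
      have : i j (J j) ∈ J (j + 1) := by
        rw [hJ]
        simp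
      exact hiJ k (J k) (hJmono hjk (heq ▸ this))
  exact Set.infinite_range_of_injective hinj
    ((s z).support.finite_toSet.subset (by rintro _ ⟨k, rfl⟩; simpa using key k))

/-- If all modules are summands of direct sums of copies of `X`, then all modules satisfy the
descending chain condition on subgroups of values. -/
theorem hasValueDCC_of_forall_isSummandOfCopies
    (hX : ∀ (Y : Type u) [AddCommGroup Y] [Module S Y], IsSummandOfCopies S X Y) :
    HasValueDCC S M := by
  classical
  intro L _ _ p K hK
  by_contra! H
  obtain ⟨I, s, r, hrs⟩ := hX (ULift.{u} ℕ → List X → M)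
  obtain ⟨n, J, hJ⟩ := exists_finset_forall_mem_valueSubgroup (p := p) hK s
  obtain ⟨d, hd, hd'⟩ := SetLike.not_le_iff_exists.1 (H n)
  let y : Set (List X) → ULift.{u} ℕ → List X → M :=
    fun A k t => if k = ⟨n⟩ ∧ t ∈ A then d else 0
  have hy : ∀ A, y A ∈ valueSubgroup (K n) p (ULift.{u} ℕ → List X → M) := fun A =>
    pi_mem_valueSubgroup fun k => pi_mem_valueSubgroup fun t => by
      dsimp only [y]
      split_ifs
      exacts [hd, zero_mem _]
  have hy0 : ∀ A (k : ULift.{u} ℕ), k.down < n → y A k = 0 := fun A k hk => by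
    have : k ≠ ⟨n⟩ := by rintro rfl; exact lt_irrefl _ hk
    ext t
    simp [y, this]
  have hsub : ∀ A B, (∀ i ∈ J, s (y A) i = s (y B) i) → A ⊆ B := by
    intro A B hAB t htA
    by_contra htB
    have hs : s (y A - y B) ∈ valueSubgroup (K (n + 1)) p (I →₀ X) :=
      finsupp_mem_valueSubgroup fun i => by
        by_cases hi : i ∈ J
        · simp [hAB i hi]
        · exact hJ _ (sub_mem (hy A) (hy B)) (fun k hk => by simp [hy0 _ _ hk]) i hi
    have := map_mem_valueSubgroup (LinearMap.proj t ∘ₗ LinearMap.proj (⟨n⟩ : ULift ℕ) ∘ₗ r) hs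
    rw [LinearMap.comp_apply, LinearMap.comp_apply, ← LinearMap.comp_apply r, hrs] at this
    exact hd' (by simpa [y, htA, htB] using this)
  refine Function.cantor_injective
    (fun A => J.toList.map fun i => s (y A) i) fun A B hAB => ?_
  have hAB' : ∀ i ∈ J, s (y A) i = s (y B) i := by simpa using hAB
  exact (hsub A B hAB').antisymm (hsub B A fun i hi => (hAB' i hi).symm)

end ChainCondition

section PureMono

variable {R : Type u} [Ring R] {M N : Type u} [AddCommGroup M] [AddCommGroup N]
  [Module Rᵐᵒᵖ M] [Module Rᵐᵒᵖ N]

/-- Finite systems of linear equations with constants in a pure submodule that are solvable in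
the ambient module are solvable in the submodule. -/
theorem IsPureMono.isFinitelySolvable {f : M →ₗ[Rᵐᵒᵖ] N} (hf : IsPureMono R f) :
    IsFinitelySolvable Rᵐᵒᵖ
      {e : (N →₀ Rᵐᵒᵖ) × M | Finsupp.linearCombination Rᵐᵒᵖ id e.1 = f e.2} := by
  classical
  intro D hD hfin
  let V : Finset N := hfin.toFinset.biUnion fun e => e.1.support
  let res : (N →₀ Rᵐᵒᵖ) →ₗ[Rᵐᵒᵖ] V →₀ Rᵐᵒᵖ := Finsupp.lsubtypeDomain (V : Set N)
  let π : (V →₀ Rᵐᵒᵖ) →ₗ[Rᵐᵒᵖ] N := Finsupp.linearCombination Rᵐᵒᵖ Subtype.val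
  have hπ : ∀ e ∈ D, π (res e.1) = f e.2 := fun e he => by
    rw [← hD he]
    have hV : ∀ x, e.1 x ≠ 0 → x ∈ V := fun x hx =>
      Finset.mem_biUnion.2 ⟨e, hfin.mem_toFinset.2 he, Finsupp.mem_support_iff.2 hx⟩
    exact Finsupp.sum_subtypeDomain_index (v := e.1) (h := fun x (c : Rᵐᵒᵖ) => c • x)
      fun x hx => hV x (Finsupp.mem_support_iff.1 hx)
  let K : Submodule Rᵐᵒᵖ (V →₀ Rᵐᵒᵖ) := Submodule.span Rᵐᵒᵖ ((fun e => res e.1) '' D)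
  have hKfg : K.FG := Submodule.fg_span (hfin.image _)
  have hP : Module.FinitePresentation Rᵐᵒᵖ ((V →₀ Rᵐᵒᵖ) ⧸ K) :=
    Module.finitePresentation_of_surjective K.mkQ K.mkQ_surjective (by rwa [K.ker_mkQ])
  obtain ⟨g, hg⟩ := hf.2 _ hP (K.liftQ ((LinearMap.range f).mkQ ∘ₗ π) (Submodule.span_le.2 (by
    rintro _ ⟨e, he, rfl⟩
    simp [hπ e he])))
  have hrange : ∀ v, (π - g ∘ₗ K.mkQ) v ∈ LinearMap.range f := fun v => by
    have := LinearMap.congr_fun hg (K.mkQ v)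
    rw [← (LinearMap.range f).ker_mkQ, LinearMap.mem_ker, LinearMap.sub_apply, map_sub,
      sub_eq_zero]
    exact this.symm
  let h : (V →₀ Rᵐᵒᵖ) →ₗ[Rᵐᵒᵖ] M :=
    (LinearEquiv.ofInjective f hf.1).symm.toLinearMap ∘ₗ LinearMap.codRestrict _ _ hrange
  have hfh : ∀ v, f (h v) = π v - g (K.mkQ v) := fun v =>
    congrArg Subtype.val ((LinearEquiv.ofInjective f hf.1).apply_symm_apply
      (LinearMap.codRestrict _ _ hrange v))
  refine ⟨h ∘ₗ res, fun e he => hf.1 ?_⟩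
  have hK : K.mkQ (res e.1) = 0 :=
    (Submodule.Quotient.mk_eq_zero K).2 (Submodule.subset_span ⟨e, he, rfl⟩)
  rw [LinearMap.comp_apply, hfh, hK, map_zero, sub_zero, hπ e he]

theorem IsPureMono.exists_retraction {f : M →ₗ[Rᵐᵒᵖ] N} (hf : IsPureMono R f)
    (hM : HasValueDCC Rᵐᵒᵖ M) : ∃ r : N →ₗ[Rᵐᵒᵖ] M, r ∘ₗ f = LinearMap.id := by
  obtain ⟨h, hh⟩ := hf.isFinitelySolvable.exists_solution hM
  have heq : ∀ x y, Finsupp.linearCombination Rᵐᵒᵖ id x = Finsupp.linearCombination Rᵐᵒᵖ id y →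
      h x = h y := fun x y hxy => by
    rw [← sub_eq_zero, ← map_sub]
    exact hh (x - y, 0) (by simp [hxy])
  refine ⟨⟨⟨fun n => h (Finsupp.single n 1), fun n n' => ?_⟩, fun c n => ?_⟩, ?_⟩
  · rw [← map_add]
    exact heq _ _ (by simp)
  · rw [RingHom.id_apply, ← map_smul]
    exact heq _ _ (by simp)
  · ext m
    exact hh (Finsupp.single (f m) 1, m) (by simp)

theorem IsRightPureSemisimple.exists_section (hR : IsRightPureSemisimple R) (q : M →ₗ[Rᵐᵒᵖ] N)
    (hq : ∀ (P : Type u) [AddCommGroup P] [Module Rᵐᵒᵖ P], Module.FinitePresentation Rᵐᵒᵖ P →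
      ∀ h : P →ₗ[Rᵐᵒᵖ] N, ∃ g : P →ₗ[Rᵐᵒᵖ] M, q ∘ₗ g = h) :
    ∃ s : N →ₗ[Rᵐᵒᵖ] M, q ∘ₗ s = LinearMap.id := by
  have hsurj : Function.Surjective q := fun n => by
    obtain ⟨g, hg⟩ := hq (ULift.{u} Rᵐᵒᵖ) (Module.finitePresentation_of_projective _ _)
      (LinearMap.toSpanSingleton Rᵐᵒᵖ N n ∘ₗ ULift.moduleEquiv.toLinearMap)
    exact ⟨g ⟨1⟩, by simpa using LinearMap.congr_fun hg ⟨1⟩⟩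
  have hpure : IsPureMono R (LinearMap.ker q).subtype := by
    refine ⟨Subtype.val_injective, fun P _ _ hP h => ?_⟩
    obtain ⟨g, hg⟩ := hq P hP
      ((LinearMap.range (LinearMap.ker q).subtype).liftQ q (by simp) ∘ₗ h)
    refine ⟨g, LinearMap.ext fun x => ?_⟩
    obtain ⟨y, hy⟩ := Submodule.mkQ_surjective _ (h x)
    have := LinearMap.congr_fun hg x
    rw [LinearMap.comp_apply, LinearMap.comp_apply, ← hy, Submodule.mkQ_apply,
      Submodule.liftQ_apply] at this
    rw [LinearMap.comp_apply, ← hy, ← sub_eq_zero, ← map_sub, ← LinearMap.mem_ker,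
      Submodule.ker_mkQ, Submodule.range_subtype, LinearMap.mem_ker, map_sub, this, sub_self]
  obtain ⟨r, hr⟩ := hR _ _ _ hpure
  have hker : LinearMap.ker q ≤
      LinearMap.ker (LinearMap.id - (LinearMap.ker q).subtype ∘ₗ r) := fun x hx => by
    have := LinearMap.congr_fun hr ⟨x, hx⟩
    rw [LinearMap.comp_apply, Submodule.subtype_apply] at this
    simp [this]
  refine ⟨(LinearMap.ker q).liftQ _ hker ∘ₗ
    (q.quotKerEquivOfSurjective hsurj).symm.toLinearMap, LinearMap.ext fun n => ?_⟩
  obtain ⟨m, rfl⟩ := hsurj n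
  have : (q.quotKerEquivOfSurjective hsurj).symm (q m) = (LinearMap.ker q).mkQ m :=
    (LinearEquiv.symm_apply_eq _).2 rfl
  simp [this]

end PureMono

section Generator

variable (S : Type u) [Ring S]

/-- A small set of presentations of all finitely presented modules. -/
abbrev FinitePresentationIndex : Type u :=
  Σ n : ℕ, {K : Submodule S (Fin n → S) // K.FG}

/-- The direct sum of representatives of the finitely presented modules. -/
abbrev finitePresentationSum : Type u :=
  DirectSum (FinitePresentationIndex S) fun t => (Fin t.1 → S) ⧸ t.2.1

theorem IsRightPureSemisimple.isSummandOfCopies {R : Type u} [Ring R]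
    (hR : IsRightPureSemisimple R) (Y : Type u) [AddCommGroup Y] [Module Rᵐᵒᵖ Y] :
    IsSummandOfCopies Rᵐᵒᵖ (finitePresentationSum Rᵐᵒᵖ) Y := by
  classical
  let I := finitePresentationSum Rᵐᵒᵖ →ₗ[Rᵐᵒᵖ] Y
  let q : (I →₀ finitePresentationSum Rᵐᵒᵖ) →ₗ[Rᵐᵒᵖ] Y := Finsupp.lsum ℕ fun i : I => i
  obtain ⟨s, hs⟩ := hR.exists_section q fun P _ _ hP h => by
    obtain ⟨n, K, e, hK⟩ := Module.FinitePresentation.exists_fin Rᵐᵒᵖ P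
    let t : FinitePresentationIndex Rᵐᵒᵖ := ⟨n, K, hK⟩
    let i : I := h ∘ₗ e.symm.toLinearMap ∘ₗ DirectSum.component Rᵐᵒᵖ _ _ t
    refine ⟨Finsupp.lsingle i ∘ₗ DirectSum.lof Rᵐᵒᵖ _ _ t ∘ₗ e.toLinearMap,
      LinearMap.ext fun x => ?_⟩
    have := DirectSum.component.lof_self (R := Rᵐᵒᵖ)
      (M := fun t : FinitePresentationIndex Rᵐᵒᵖ => (Fin t.1 → Rᵐᵒᵖ) ⧸ t.2.1) (i := t) (b := e x)
    simp [q, i, this, t]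
  exact ⟨I, s, q, hs⟩

end Generator

section Category

variable {S : Type u} [Ring S]

theorem isPureSemisimpleCat_moduleCat_iff :
    IsPureSemisimpleCat.{u} (ModuleCat.{u} S) ↔
      ∃ X : ModuleCat.{u} S, ∀ (Y : Type u) [AddCommGroup Y] [Module S Y],
        IsSummandOfCopies S X Y := by
  classical
  refine exists_congr fun X => ⟨fun h Y _ _ => ?_, fun h Y => ?_⟩
  · obtain ⟨I, c, hc, s, r, hsr⟩ := h (ModuleCat.of S Y)
    let e := hc.coconePointUniqueUpToIso (ModuleCat.coproductCoconeIsColimit fun _ : I => X)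
    let e' := finsuppLEquivDirectSum S X I
    refine ⟨I, e'.symm.toLinearMap ∘ₗ (s ≫ e.hom).hom, (e.inv ≫ r).hom ∘ₗ e'.toLinearMap,
      LinearMap.ext fun y => ?_⟩
    have : (s ≫ e.hom) ≫ e.inv ≫ r = 𝟙 _ := by simp [hsr]
    exact (congrArg (e.inv ≫ r).hom (e'.apply_symm_apply _)).trans congr($(this).hom y)
  · obtain ⟨I, s, r, hrs⟩ := h Y
    let e' := finsuppLEquivDirectSum S X I
    refine ⟨I, _, ModuleCat.coproductCoconeIsColimit fun _ : I => X,
      ModuleCat.ofHom (e'.toLinearMap ∘ₗ s), ModuleCat.ofHom (r ∘ₗ e'.symm.toLinearMap), ?_⟩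
    ext y
    simpa [ModuleCat.coproductCocone] using LinearMap.congr_fun hrs y

end Category

theorem right_pure_semisimple_iff_modR_pure_semisimple (R : Type u) [Ring R] :
    IsRightPureSemisimple R ↔ IsPureSemisimpleCat.{u} (ModuleCat.{u} Rᵐᵒᵖ) := by
  rw [isPureSemisimpleCat_moduleCat_iff]
  constructor
  · intro hR
    exact ⟨ModuleCat.of _ (finitePresentationSum Rᵐᵒᵖ), hR.isSummandOfCopies⟩
  · rintro ⟨X, hX⟩ M N _ _ _ _ f hf
    exact hf.exists_retraction (hasValueDCC_of_forall_isSummandOfCopies hX)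
end

section
/- For a ring R, the following are equivalent: (1) the homotopy category K(Mod-R) of complexes of all right R-modules is well generated; (2) K(Mod-R) is compactly generated; (3) R is right pure semisimple. -/
namespace LocWellGen

open CategoryTheory CategoryTheory.Limits CategoryTheory.Pretriangulated ZeroObject

universe v u

variable (T : Type u) [Category.{v} T] [HasZeroObject T] [HasShift T ℤ]
  [Preadditive T] [∀ n : ℤ, (shiftFunctor T n).Additive] [Pretriangulated T]

/-- A localizing subcategory of a pretriangulated category, given as a class of objects:
a full triangulated subcategory closed under isomorphisms and (existing) coproducts. -/
structure IsLocalizing (L : Set T) : Prop where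
  zero : (0 : T) ∈ L
  isoClosed : ∀ {X Y : T}, (X ≅ Y) → X ∈ L → Y ∈ L
  shiftClosed : ∀ (X : T) (n : ℤ), X ∈ L → X⟦n⟧ ∈ L
  ext₂ : ∀ D ∈ distTriang T, D.obj₁ ∈ L → D.obj₃ ∈ L → D.obj₂ ∈ L
  coproductClosed : ∀ {I : Type v} (X : I → T), (∀ i, X i ∈ L) →
    ∀ (c : Cofan X), IsColimit c → c.pt ∈ L

/-- `Loc S` : the smallest localizing subcategory containing `S`. -/
def Loc (S : Set T) : Set T := ⋂₀ {L : Set T | IsLocalizing T L ∧ S ⊆ L}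

/-- `Y` is `κ`-small: any morphism from `Y` to a coproduct (of objects of `L`) factors
through a subcoproduct with fewer than `κ` summands. -/
def IsKappaSmall (L : Set T) (κ : Cardinal.{v}) (Y : T) : Prop :=
  ∀ {I : Type v} (X : I → T), (∀ i, X i ∈ L) →
    ∀ (c : Cofan X), IsColimit c → ∀ f : Y ⟶ c.pt,
      ∃ (J : Set I) (c' : Cofan fun j : J => X j) (hc' : IsColimit c') (g : Y ⟶ c'.pt),
        Cardinal.mk J < κ ∧
        f = g ≫ hc'.desc (Cofan.mk c.pt fun j : J => c.inj j.1)

/-- Condition (3) of well generation: every morphism from `Y` to a coproduct of a family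
in `L` factors through a coproduct of objects of `S` via a coproduct of morphisms. -/
def FactorsThroughFamily (L S : Set T) (Y : T) : Prop :=
  ∀ {I : Type v} (X : I → T), (∀ i, X i ∈ L) →
    ∀ (c : Cofan X), IsColimit c → ∀ f : Y ⟶ c.pt,
      ∃ (Z : I → T) (_ : ∀ i, Z i ∈ S) (φ : ∀ i, Z i ⟶ X i)
        (cz : Cofan Z) (hcz : IsColimit cz) (g : Y ⟶ cz.pt),
        f = g ≫ hcz.desc (Cofan.mk c.pt fun i => φ i ≫ c.inj i)

/-- The set `S` witnesses that the (localizing sub)category `L` is `κ`-well generated. -/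
structure GeneratesWell (L : Set T) (κ : Cardinal.{v}) (S : Set T) : Prop where
  subset : S ⊆ L
  isSmall : Small.{v} ↥S
  nondegenerate : ∀ X ∈ L, (∀ Y ∈ S, ∀ f : Y ⟶ X, f = 0) → IsZero X
  kappaSmall : ∀ Y ∈ S, IsKappaSmall T L κ Y
  factors : ∀ Y ∈ S, FactorsThroughFamily T L S Y

/-- `L` is a `κ`-well generated (localizing sub)category. -/
def IsWellGeneratedOfCard (L : Set T) (κ : Cardinal.{v}) : Prop :=
  κ.IsRegular ∧ ∃ S : Set T, GeneratesWell T L κ S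

/-- `L` is a well generated (localizing sub)category. -/
def IsWellGeneratedSubcat (L : Set T) : Prop :=
  ∃ κ : Cardinal.{v}, IsWellGeneratedOfCard T L κ

/-- compactly generated = `ℵ₀`-well generated -/
def IsCompactlyGeneratedSubcat (L : Set T) : Prop :=
  IsWellGeneratedOfCard T L Cardinal.aleph0

/-- The whole category `T` is well generated. -/
abbrev IsWellGenerated : Prop := IsWellGeneratedSubcat T Set.univ

/-- A localizing subcategory `L` is locally well generated if the localizing subcategory
generated by any set of its objects is well generated. -/
def IsLocallyWellGeneratedSubcat (L : Set T) : Prop :=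
  ∀ S : Set T, S ⊆ L → Small.{v} ↥S → IsWellGeneratedSubcat T (Loc T S)

/-- `T` is locally well generated. -/
abbrev IsLocallyWellGenerated : Prop := IsLocallyWellGeneratedSubcat T Set.univ

/-- `Y` is a retract (direct summand) of `X`. -/
def IsRetractOf {B : Type*} [Category B] (Y X : B) : Prop :=
  ∃ (s : Y ⟶ X) (r : X ⟶ Y), s ≫ r = 𝟙 Y

end LocWellGen

namespace LocWellGen

open CategoryTheory CategoryTheory.Limits

universe v u
/-- An additive category with arbitrary coproducts is pure semisimple if it has an
additive generator: `B = Add X` for some `X`, i.e. every object is a direct summand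
of a coproduct of copies of `X`. -/
def IsPureSemisimple (B : Type u) [Category.{v} B] : Prop :=
  ∃ X : B, ∀ Y : B, ∃ (I : Type v) (c : Cofan fun _ : I => X) (_ : IsColimit c),
    IsRetractOf Y c.pt

end LocWellGen

namespace LocWellGen

universe u' 

/-- `f` is a pure monomorphism of right `R`-modules: it is injective, and every homomorphism
from a finitely presented module to its cokernel lifts along the projection. -/
def IsPureMono (R : Type u') [Ring R] {M N : Type u'} [AddCommGroup M] [AddCommGroup N]
    [Module Rᵐᵒᵖ M] [Module Rᵐᵒᵖ N] (f : M →ₗ[Rᵐᵒᵖ] N) : Prop :=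
  Function.Injective f ∧
    ∀ (P : Type u') [AddCommGroup P] [Module Rᵐᵒᵖ P], Module.FinitePresentation Rᵐᵒᵖ P →
      ∀ h : P →ₗ[Rᵐᵒᵖ] N ⧸ LinearMap.range f,
        ∃ g : P →ₗ[Rᵐᵒᵖ] N, (LinearMap.range f).mkQ.comp g = h

/-- `R` is right pure semisimple: every pure monomorphism between right `R`-modules splits. -/
def IsRightPureSemisimple (R : Type u') [Ring R] : Prop :=
  ∀ (M N : Type u') [AddCommGroup M] [AddCommGroup N] [Module Rᵐᵒᵖ M] [Module Rᵐᵒᵖ N]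
    (f : M →ₗ[Rᵐᵒᵖ] N), IsPureMono R f →
      ∃ r : N →ₗ[Rᵐᵒᵖ] M, r.comp f = LinearMap.id

end LocWellGen

namespace LocWellGen

universe u

/-- A functorial family of subgroups of left `S`-modules which is compatible with powers. -/
structure PPFunctor (S : Type u) [Ring S] where
  carrier : ∀ (M : Type u) [AddCommGroup M] [Module S M], AddSubgroup M
  map_mem : ∀ {M N : Type u} [AddCommGroup M] [Module S M] [AddCommGroup N] [Module S N]
    (f : M →ₗ[S] N) {x : M}, x ∈ carrier M → f x ∈ carrier N
  pi_mem : ∀ {K M : Type u} [AddCommGroup M] [Module S M] {x : K → M},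
    (∀ k, x k ∈ carrier M) → x ∈ carrier (K → M)

section

variable {S : Type u} [Ring S]

theorem PPFunctor.finsupp_mem (φ : PPFunctor S) {I U : Type u} [AddCommGroup U] [Module S U]
    {b : I →₀ U} (hb : ∀ i, b i ∈ φ.carrier U) : b ∈ φ.carrier (I →₀ U) := by
  rw [← b.sum_single]
  exact AddSubgroup.sum_mem _ fun i _ => φ.map_mem (Finsupp.lsingle i) (hb i)

/-- A variant of Chase's lemma on maps from products to direct sums. -/
theorem exists_forall_mem_of_map_pi_finsupp {K M I U : Type u} [AddCommGroup M] [Module S M]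
    [AddCommGroup U] [Module S U] (φ : ℕ → PPFunctor S)
    (hM : Antitone fun n => (φ n).carrier M) (hU : Antitone fun n => (φ n).carrier U)
    (f : (ℕ × K → M) →ₗ[S] (I →₀ U)) :
    ∃ (n : ℕ) (F : Finset I), ∀ x : ℕ × K → M, (∀ p, x p ∈ (φ n).carrier M) →
      (∀ p, p.1 < n → x p = 0) → ∀ i ∉ F, ∀ m, f x i ∈ (φ m).carrier U := by
  classical
  by_contra! H
  choose x hx hx0 i hi m hm using H
  let st : ℕ → ℕ × Finset I := fun k => Nat.rec (0, ∅)
    (fun _ s => (max (s.1 + 1) (m s.1 s.2), s.2 ∪ (f (x s.1 s.2)).support)) k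
  let n : ℕ → ℕ := fun k => (st k).1
  let F : ℕ → Finset I := fun k => (st k).2
  let y : ℕ → ℕ × K → M := fun k => x (n k) (F k)
  let j : ℕ → I := fun k => i (n k) (F k)
  have hn1 (k : ℕ) : n (k + 1) = max (n k + 1) (m (n k) (F k)) := rfl
  have hF1 (k : ℕ) : F (k + 1) = F k ∪ (f (y k)).support := rfl
  have hnm : StrictMono n := strictMono_nat_of_lt_succ fun k => by rw [hn1]; omega
  have hFm : Monotone F := monotone_nat_of_le_succ fun k => by
    rw [hF1]; exact Finset.subset_union_left
  have hy (k : ℕ) (p) : y k p ∈ (φ (n k)).carrier M := hx _ _ p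
  have hy0 (k : ℕ) (p : ℕ × K) (h : p.1 < n k) : y k p = 0 := hx0 _ _ p h
  have hj (k : ℕ) : j k ∉ F k := hi _ _
  have hjm (k : ℕ) : f (y k) (j k) ∉ (φ (n (k + 1))).carrier U := fun h =>
    hm (n k) (F k) (hU (by rw [hn1]; exact le_max_right _ _) h)
  have hsupp {k l : ℕ} (h : k < l) : (f (y k)).support ⊆ F l :=
    (Finset.subset_union_right.trans (hF1 k).ge).trans (hFm h)
  let z : ℕ × K → M := fun p => ∑ k ∈ Finset.range (p.1 + 1), y k p
  have htail (l : ℕ) : z - ∑ k ∈ Finset.range l, y k ∈ (φ (n l)).carrier (ℕ × K → M) := by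
    refine (φ (n l)).pi_mem fun p => ?_
    simp only [Pi.sub_apply, Finset.sum_apply, z]
    rcases le_total (p.1 + 1) l with h | h
    · rw [← Finset.sum_subset (Finset.range_mono h) fun k _ hk => hy0 k p ?_, sub_self]
      · exact AddSubgroup.zero_mem _
      · have := hnm.le_apply (x := k)
        simp only [Finset.mem_range] at hk
        omega
    · rw [← Finset.sum_Ico_eq_sub _ h]
      exact AddSubgroup.sum_mem _ fun k hk =>
        hM (hnm.monotone (Finset.mem_Ico.1 hk).1) (hy k p)
  have hz (l : ℕ) : f z (j l) ≠ 0 := fun h0 => by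
    have h1 := (φ (n (l + 1))).map_mem (Finsupp.lapply (j l) ∘ₗ f) (htail (l + 1))
    rw [map_sub, map_sum, Finset.sum_range_succ, Finset.sum_eq_zero, LinearMap.comp_apply,
      LinearMap.comp_apply, Finsupp.lapply_apply, Finsupp.lapply_apply, h0, zero_add,
      zero_sub, neg_mem_iff] at h1
    · exact hjm l h1
    · intro k hk
      exact Finsupp.notMem_support_iff.1 fun h => hj l (hsupp (Finset.mem_range.1 hk) h)
  have hjsupp (k : ℕ) : j k ∈ (f (y k)).support := Finsupp.mem_support_iff.2 fun h =>
    hjm k (h ▸ AddSubgroup.zero_mem _)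
  have hlt {k l : ℕ} (h : k < l) : j k ≠ j l := fun e => hj l (e ▸ hsupp h (hjsupp k))
  have hinj : Function.Injective j := fun k l e => by
    rcases lt_trichotomy k l with h | h | h
    · exact (hlt h e).elim
    · exact h
    · exact (hlt h e.symm).elim
  exact not_injective_infinite_finite
    (fun k : ℕ => (⟨j k, Finsupp.mem_support_iff.2 (hz k)⟩ : (f z).support))
    fun k l e => hinj (congrArg Subtype.val e)

/-- `Mod-S = Add U`: every module is a direct summand of a direct sum of copies of `U`. -/
def IsAddGenerator (S U : Type u) [Ring S] [AddCommGroup U] [Module S U] : Prop :=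
  ∀ (M : Type u) [AddCommGroup M] [Module S M], ∃ (I : Type u) (s : M →ₗ[S] (I →₀ U))
    (r : (I →₀ U) →ₗ[S] M), r ∘ₗ s = LinearMap.id

theorem IsAddGenerator.exists_carrier_le {U : Type u} [AddCommGroup U] [Module S U]
    (hU : IsAddGenerator S U) (φ : ℕ → PPFunctor S)
    (hφ : ∀ (M : Type u) [AddCommGroup M] [Module S M], Antitone fun n => (φ n).carrier M)
    (M : Type u) [AddCommGroup M] [Module S M] :
    ∃ n, ∀ m, (φ n).carrier M ≤ (φ m).carrier M := by
  classical
  let K := ℕ → U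
  obtain ⟨I, s, r, hrs⟩ := hU (ℕ × K → M)
  obtain ⟨n, F, hF⟩ := exists_forall_mem_of_map_pi_finsupp φ (hφ M) (hφ U) s
  refine ⟨n, fun m a ha => ?_⟩
  by_contra ham
  let x : Set K → ℕ × K → M := fun T p => if p.1 = n ∧ p.2 ∈ T then a else 0
  have hx (T : Set K) (p) : x T p ∈ (φ n).carrier M := by
    simp only [x]; split_ifs
    exacts [ha, AddSubgroup.zero_mem _]
  have hx0 (T : Set K) (p : ℕ × K) (h : p.1 < n) : x T p = 0 := if_neg fun h' => h.ne h'.1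
  obtain ⟨e, he⟩ := Countable.exists_injective_nat F
  refine Function.cantor_injective
    (fun T : Set K => Function.extend e (fun i : F => s (x T) i) 0) fun T T' hT => ?_
  have hs (i : I) (hi : i ∈ F) : s (x T) i = s (x T') i := by
    simpa [he.extend_apply] using congrFun hT (e ⟨i, hi⟩)
  have hmem : s (x T - x T') ∈ (φ m).carrier (I →₀ U) := by
    refine (φ m).finsupp_mem fun i => ?_
    rw [map_sub, Finsupp.sub_apply]
    by_cases hi : i ∈ F
    · rw [hs i hi, sub_self]; exact AddSubgroup.zero_mem _
    · exact AddSubgroup.sub_mem _ (hF _ (hx T) (hx0 T) i hi m) (hF _ (hx T') (hx0 T') i hi m)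
  have hmem' : x T - x T' ∈ (φ m).carrier (ℕ × K → M) := by
    have := (φ m).map_mem r hmem
    rwa [← LinearMap.comp_apply, hrs] at this
  ext t
  have ht := (φ m).map_mem (LinearMap.proj (n, t)) hmem'
  by_cases h : t ∈ T <;> by_cases h' : t ∈ T' <;> simp [x, h, h', ham] at ht ⊢

/-- The family of equations `Q` between elements of `N` is finitely solvable in `M`,
relatively to the values prescribed by `f : M →ₗ[S] N`. -/
def IsFinitelySolvable {M N : Type u} [AddCommGroup M] [Module S M] [AddCommGroup N]
    [Module S N] (f : M →ₗ[S] N) (Q : Set (N →₀ S)) : Prop :=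
  ∀ Q' : Finset (N →₀ S), (Q' : Set (N →₀ S)) ⊆ Q → ∃ h : N → M, (∀ c, h (f c) = c) ∧
    ∀ q ∈ Q', Finsupp.linearCombination S h q = 0

/-- The solutions for the variable `x` of the homogeneous system attached to `Q`. -/
def solutions {M N : Type u} (f : M → N) (Q : Set (N →₀ S)) (x : N) : PPFunctor S where
  carrier A _ _ :=
    { carrier := {a | ∃ h : N → A, h x = a ∧ (∀ c, h (f c) = 0) ∧
        ∀ q ∈ Q, Finsupp.linearCombination S h q = 0}
      zero_mem' := ⟨0, rfl, fun _ => rfl, fun q _ => by simp⟩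
      add_mem' := by
        rintro _ _ ⟨h, rfl, h1, h2⟩ ⟨k, rfl, k1, k2⟩
        refine ⟨h + k, rfl, fun c => by simp [h1, k1], fun q hq => ?_⟩
        have := congrArg₂ (· + ·) (h2 q hq) (k2 q hq)
        simpa [Finsupp.linearCombination_apply, Finsupp.sum, Finset.sum_add_distrib] using this
      neg_mem' := by
        rintro _ ⟨h, rfl, h1, h2⟩
        refine ⟨-h, rfl, fun c => by simp [h1], fun q hq => ?_⟩
        simpa [Finsupp.linearCombination_apply, Finsupp.sum] using h2 q hq }
  map_mem := by
    rintro A B _ _ _ _ g _ ⟨h, rfl, h1, h2⟩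
    refine ⟨g ∘ h, rfl, fun c => by simp [h1], fun q hq => ?_⟩
    simpa [Finsupp.linearCombination_apply, Finsupp.sum] using congrArg g (h2 q hq)
  pi_mem := by
    intro K A _ _ a ha
    choose h h0 h1 h2 using ha
    refine ⟨fun n k => h k n, funext h0, fun c => funext fun k => h1 k c, fun q hq => ?_⟩
    ext k
    simpa [Finsupp.linearCombination_apply, Finsupp.sum] using h2 k q hq

theorem solutions_anti {M N : Type u} (f : M → N) (x : N) {Q Q' : Set (N →₀ S)} (h : Q ⊆ Q')
    (A : Type u) [AddCommGroup A] [Module S A] :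
    (solutions f Q' x).carrier A ≤ (solutions f Q x).carrier A := by
  rintro _ ⟨k, rfl, h1, h2⟩
  exact ⟨k, rfl, h1, fun q hq => h2 q (h hq)⟩

theorem IsAddGenerator.exists_minimal_solutions {U M N : Type u} [AddCommGroup U] [Module S U]
    [AddCommGroup M] [Module S M] (hU : IsAddGenerator S U) (f : M → N) (x : N)
    (Q : Set (N →₀ S)) : ∃ Q₁ : Finset (N →₀ S), (Q₁ : Set (N →₀ S)) ⊆ Q ∧
      ∀ Q₂ : Finset (N →₀ S), (Q₂ : Set (N →₀ S)) ⊆ Q →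
        (solutions f (Q₁ : Set (N →₀ S)) x).carrier M ≤
          (solutions f ((Q₁ ∪ Q₂ : Set (N →₀ S))) x).carrier M := by
  classical
  by_contra! H
  choose! g hg hg' using H
  let Q₁ (n : ℕ) : Finset (N →₀ S) := Nat.rec ∅ (fun _ A => A ∪ g A) n
  have h1 (n) : Q₁ (n + 1) = Q₁ n ∪ g (Q₁ n) := rfl
  have h2 (n : ℕ) : SetLike.coe (Q₁ n) ⊆ Q := by
    induction n with
    | zero => simp [Q₁]
    | succ n ih => rw [h1, Finset.coe_union]; exact Set.union_subset ih (hg _ ih)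
  have h3 : Monotone Q₁ := monotone_nat_of_le_succ fun n => by
    rw [h1]; exact Finset.subset_union_left
  obtain ⟨n, hn⟩ := hU.exists_carrier_le (fun n => solutions f (SetLike.coe (Q₁ n)) x)
    (fun A _ _ m k hmk => solutions_anti f x (Finset.coe_subset.2 (h3 hmk)) A) M
  refine hg' (Q₁ n) (h2 n) ?_
  rw [← Finset.coe_union, ← h1]
  exact hn (n + 1)

section

variable {U M N : Type u} [AddCommGroup U] [Module S U] [AddCommGroup M] [Module S M]
  [AddCommGroup N] [Module S N]

theorem IsAddGenerator.exists_value (hU : IsAddGenerator S U) {f : M →ₗ[S] N}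
    {Q : Set (N →₀ S)} (hQ : IsFinitelySolvable f Q) (x : N) : ∃ m : M,
      ∀ Q' : Finset (N →₀ S), (Q' : Set (N →₀ S)) ⊆ Q → ∃ h : N → M, (∀ c, h (f c) = c) ∧
        h x = m ∧ ∀ q ∈ Q', Finsupp.linearCombination S h q = 0 := by
  classical
  obtain ⟨Q₁, hQ₁, hmin⟩ := hU.exists_minimal_solutions f x Q
  obtain ⟨h₁, h₁f, h₁Q⟩ := hQ Q₁ hQ₁
  refine ⟨h₁ x, fun Q₂ hQ₂ => ?_⟩
  obtain ⟨h₂, h₂f, h₂Q⟩ := hQ (Q₁ ∪ Q₂) (by simp [hQ₁, hQ₂])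
  obtain ⟨k, kx, kf, kQ⟩ := hmin Q₂ hQ₂ (show h₁ x - h₂ x ∈ _ from ⟨h₁ - h₂, rfl,
    fun c => by simp [h₁f, h₂f], fun q hq => by
      have e₁ := h₁Q q hq
      have e₂ := h₂Q q (Finset.mem_union_left _ hq)
      have := congrArg₂ (· - ·) e₁ e₂
      simpa [Finsupp.linearCombination_apply, Finsupp.sum, smul_sub] using this⟩)
  refine ⟨h₂ + k, fun c => by simp [h₂f, kf], by simp [kx], fun q hq => ?_⟩
  have e₁ := h₂Q q (Finset.mem_union_right _ hq)
  have e₂ := kQ q (Or.inr hq)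
  have := congrArg₂ (· + ·) e₁ e₂
  simpa [Finsupp.linearCombination_apply, Finsupp.sum, Finset.sum_add_distrib] using this

theorem IsAddGenerator.exists_retraction (hU : IsAddGenerator S U) {f : M →ₗ[S] N}
    (hf : IsFinitelySolvable f {q | Finsupp.linearCombination S id q = 0}) :
    ∃ r : N →ₗ[S] M, r ∘ₗ f = LinearMap.id := by
  classical
  obtain ⟨Q, hQ0, hQ⟩ := zorn_subset_nonempty {Q | IsFinitelySolvable f Q} (fun c hc hc' hne =>
    ⟨⋃₀ c, fun Q' hQ' => by
      obtain ⟨Q, hQ, hQQ'⟩ := hc'.directedOn.exists_mem_subset_of_finset_subset_biUnion hne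
        (f := id) (s := Q') (hQ'.trans_eq Set.sUnion_eq_biUnion)
      exact hc hQ Q' hQQ', fun s hs => Set.subset_sUnion_of_mem hs⟩) _ hf
  have key (x : N) : ∃ m : M, Finsupp.single x 1 - Finsupp.single (f m) 1 ∈ Q := by
    obtain ⟨m, hm⟩ := hU.exists_value hQ.prop x
    refine ⟨m, hQ.le_of_ge (y := insert _ Q) ?_ (Set.subset_insert _ _) (Set.mem_insert _ _)⟩
    intro Q' hQ'
    obtain ⟨h, hf, hx, hq⟩ := hm (Q'.erase (Finsupp.single x 1 - Finsupp.single (f m) 1))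
      (by
        rw [Finset.coe_erase]
        exact Set.sdiff_singleton_subset_iff.2 hQ')
    refine ⟨h, hf, fun q hqQ => ?_⟩
    by_cases e : q = Finsupp.single x 1 - Finsupp.single (f m) 1
    · simp [e, hf, hx]
    · exact hq q (Finset.mem_erase.2 ⟨e, hqQ⟩)
  choose r hr using key
  have hrel (q : N →₀ S) (hq : Finsupp.linearCombination S id q = 0) :
      Finsupp.linearCombination S r q = 0 := by
    obtain ⟨h, hf, hq⟩ := hQ.prop (insert q (q.support.image fun x =>
      Finsupp.single x 1 - Finsupp.single (f (r x)) 1)) (by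
        simp only [Finset.coe_insert, Finset.coe_image, Set.insert_subset_iff]
        refine ⟨hQ0 hq, ?_⟩
        rintro _ ⟨x, -, rfl⟩
        exact hr x)
    rw [← hq q (by simp), Finsupp.linearCombination_apply, Finsupp.linearCombination_apply]
    refine Finset.sum_congr rfl fun x hx => ?_
    have := hq _ (Finset.mem_insert_of_mem (Finset.mem_image_of_mem _ hx))
    simp only [map_sub, Finsupp.linearCombination_single, one_smul, hf, sub_eq_zero] at this
    simp only [this]
  refine ⟨{ toFun := r, map_add' := fun x y => ?_, map_smul' := fun s x => ?_ }, ?_⟩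
  · have := hrel (Finsupp.single (x + y) 1 - Finsupp.single x 1 - Finsupp.single y 1) (by simp)
    simpa [sub_sub, sub_eq_zero] using this
  · have := hrel (Finsupp.single (s • x) 1 - Finsupp.single x s) (by simp)
    simpa [sub_eq_zero] using this
  · ext c
    obtain ⟨h, hf, hq⟩ := hQ.prop {Finsupp.single (f c) 1 - Finsupp.single (f (r (f c))) 1}
      (by simpa using hr (f c))
    have := hq _ (Finset.mem_singleton_self _)
    simp only [map_sub, Finsupp.linearCombination_single, one_smul, hf, sub_eq_zero] at this
    exact this.symm

theorem isFinitelySolvable_of_lift {f : M →ₗ[S] N} (hf : Function.Injective f)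
    (hlift : ∀ (P : Type u) [AddCommGroup P] [Module S P], Module.FinitePresentation S P →
      ∀ h : P →ₗ[S] N ⧸ LinearMap.range f,
        ∃ g : P →ₗ[S] N, (LinearMap.range f).mkQ.comp g = h) :
    IsFinitelySolvable f {q | Finsupp.linearCombination S id q = 0} := by
  classical
  intro Q hQ
  let V : Finset N := Q.biUnion fun q => q.support
  let rel : Set (V →₀ S) := (fun q : N →₀ S => q.comapDomain (Subtype.val : V → N)
    Subtype.val_injective.injOn) '' Q ∪
      (fun v => Finsupp.single v 1) '' {v | v.1 ∈ LinearMap.range f}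
  have hrel : rel.Finite := (Q.finite_toSet.image _).union (Set.toFinite _)
  have hQV (q) (hq : q ∈ Q) : (q.support : Set N) ⊆ Set.range (Subtype.val : V → N) := by
    intro v hv
    exact ⟨⟨v, Finset.mem_biUnion.2 ⟨q, hq, hv⟩⟩, rfl⟩
  have hlc (A : Type u) [AddCommGroup A] [Module S A] (k : N → A) (q) (hq : q ∈ Q) :
      Finsupp.linearCombination S (fun v : V => k v) (q.comapDomain (Subtype.val : V → N)
        Subtype.val_injective.injOn) = Finsupp.linearCombination S k q := by
    conv_rhs => rw [← Finsupp.mapDomain_comapDomain _ Subtype.val_injective q (hQV q hq)]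
    rw [Finsupp.linearCombination_mapDomain]
    rfl
  let p : (V →₀ S) →ₗ[S] N ⧸ LinearMap.range f :=
    Finsupp.linearCombination S fun v : V => (LinearMap.range f).mkQ v
  have hp : Submodule.span S rel ≤ LinearMap.ker p := by
    rw [Submodule.span_le]
    rintro _ (⟨q, hq, rfl⟩ | ⟨v, hv, rfl⟩)
    · have := hlc _ (fun v => (LinearMap.range f).mkQ v) q hq
      refine this.trans ?_
      have h0 := congrArg (LinearMap.range f).mkQ (hQ hq)
      simpa [Finsupp.linearCombination_apply, Finsupp.sum] using h0
    · simpa [p] using hv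
  have hfp : Module.FinitePresentation S ((V →₀ S) ⧸ Submodule.span S rel) :=
    Module.finitePresentation_of_surjective _ (Submodule.mkQ_surjective _) (by
      rw [Submodule.ker_mkQ]
      exact ⟨hrel.toFinset, by simp⟩)
  obtain ⟨g, hg⟩ := hlift _ hfp ((Submodule.span S rel).liftQ p hp)
  let e : N → N := fun n => if hn : n ∈ V then
    g ((Submodule.span S rel).mkQ (Finsupp.single ⟨n, hn⟩ 1)) else 0
  have he (n) (hn : n ∈ V) : n - e n ∈ LinearMap.range f := by
    have := LinearMap.congr_fun hg ((Submodule.span S rel).mkQ (Finsupp.single ⟨n, hn⟩ 1))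
    simp only [LinearMap.comp_apply, Submodule.mkQ_apply, Submodule.liftQ_apply, p,
      Finsupp.linearCombination_single, one_smul] at this
    simpa [e, hn] using (Submodule.Quotient.eq _).1 this.symm
  have he0 (c) : e (f c) = 0 := by
    by_cases hn : f c ∈ V
    · have h1 : (Submodule.span S rel).mkQ (Finsupp.single ⟨f c, hn⟩ 1) = 0 := by
        rw [Submodule.mkQ_apply, Submodule.Quotient.mk_eq_zero]
        exact Submodule.subset_span (Or.inr ⟨_, ⟨c, rfl⟩, rfl⟩)
      simp only [e, dif_pos hn, h1, map_zero]
    · simp only [e, dif_neg hn]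
  let h : N → M := fun n => if hn : n - e n ∈ LinearMap.range f then hn.choose else 0
  have hfh (n) (hn : n - e n ∈ LinearMap.range f) : f (h n) = n - e n := by
    simp only [h, dif_pos hn]
    exact hn.choose_spec
  refine ⟨h, fun c => hf ?_, fun q hq => hf ?_⟩
  · rw [hfh _ ⟨c, by rw [he0, sub_zero]⟩, he0, sub_zero]
  · have h1 : Finsupp.linearCombination S e q = 0 := by
      rw [← hlc _ _ q hq]
      have h2 : (fun v : V => e v) =
          fun v => (g ∘ₗ (Submodule.span S rel).mkQ) (Finsupp.single v 1) := by
        ext v; simp [e]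
      have h3 : Finsupp.linearCombination S (fun v : V => e v) =
          g ∘ₗ (Submodule.span S rel).mkQ := by
        rw [h2]; ext v; simp
      rw [h3, LinearMap.comp_apply, (LinearMap.mem_ker (f := (Submodule.span S rel).mkQ)).1,
        map_zero]
      rw [Submodule.ker_mkQ]
      exact Submodule.subset_span (Or.inl ⟨q, hq, rfl⟩)
    have h4 := hQ hq
    simp only [Set.mem_ofPred_eq, Finsupp.linearCombination_apply, Finsupp.sum] at h1 h4 ⊢
    rw [map_sum, map_zero]
    have h5 : ∑ n ∈ q.support, f (q n • h n) = ∑ n ∈ q.support, (q n • id n - q n • e n) :=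
      Finset.sum_congr rfl fun n hn => by
        rw [map_smul, hfh n (he n (Finset.mem_biUnion.2 ⟨q, hq, hn⟩)), smul_sub, id]
    rw [h5, Finset.sum_sub_distrib, h1, h4, sub_zero]

end

theorem IsAddGenerator.isRightPureSemisimple {R U : Type u} [Ring R] [AddCommGroup U]
    [Module Rᵐᵒᵖ U] (hU : IsAddGenerator Rᵐᵒᵖ U) : IsRightPureSemisimple R := by
  intro M N _ _ _ _ f hf
  exact hU.exists_retraction (isFinitelySolvable_of_lift hf.1 hf.2)

end

end LocWellGen

namespace LocWellGen

open CategoryTheory CategoryTheory.Limits CategoryTheory.Pretriangulated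

universe w v u

section Triangulated

variable {T : Type u} [Category.{v} T]

theorem FactorsThroughFamily.comp_eq_zero [HasZeroObject T] [HasShift T ℤ] [Preadditive T]
    [∀ n : ℤ, (shiftFunctor T n).Additive] [Pretriangulated T] {S : Set T} {Y : T}
    (hY : FactorsThroughFamily T Set.univ S Y) {I : Type v} {X : I → T} {P Q : T}
    {g : ∀ i, X i ⟶ P} (hP : IsColimit (Cofan.mk P g)) (s : P ⟶ Q)
    (hs : ∀ i, ∀ Z ∈ S, ∀ f : Z ⟶ X i, f ≫ g i ≫ s = 0) (f : Y ⟶ P) : f ≫ s = 0 := by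
  obtain ⟨Z, hZ, φ, cz, hcz, u, hu⟩ := hY X (fun _ => trivial) _ hP f
  have : hcz.desc (Cofan.mk P fun i => φ i ≫ g i) ≫ s = 0 :=
    Cofan.IsColimit.hom_ext hcz _ _ fun i => by
      have : cz.inj i ≫ hcz.desc (Cofan.mk P fun i => φ i ≫ g i) = φ i ≫ g i :=
        hcz.fac (Cofan.mk P fun i => φ i ≫ g i) ⟨i⟩
      rw [reassoc_of% this, comp_zero, hs i _ (hZ i)]
  have h2 : f = u ≫ hcz.desc (Cofan.mk P fun i => φ i ≫ g i) := hu
  rw [h2, Category.assoc, this, comp_zero]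

theorem GeneratesWell.isIso_id_sub [HasZeroObject T] [HasShift T ℤ] [Preadditive T]
    [∀ n : ℤ, (shiftFunctor T n).Additive] [Pretriangulated T] {S : Set T} {κ : Cardinal.{v}}
    (hS : GeneratesWell T Set.univ κ S) {I : Type v} {X : I → T} {P : T}
    {g : ∀ i, X i ⟶ P} (hP : IsColimit (Cofan.mk P g)) (s : P ⟶ P)
    (hs₀ : ∀ i, ∀ Z ∈ S, ∀ f : Z ⟶ X i, f ≫ g i ≫ s = 0)
    (hs₁ : ∀ i, ∀ Z ∈ S, ∀ f : Z ⟶ (X i)⟦(1 : ℤ)⟧, f ≫ (g i ≫ s)⟦(1 : ℤ)⟧' = 0) :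
    IsIso (𝟙 P - s) := by
  obtain ⟨C, a, b, hT⟩ := distinguished_cocone_triangle (𝟙 P - s)
  refine (Triangle.isZero₃_iff_isIso₁ _ hT).1 (hS.nondegenerate C trivial fun Y hY y => ?_)
  have h₁ : (y ≫ b) ≫ (𝟙 P - s)⟦(1 : ℤ)⟧' = 0 := by
    have : b ≫ (𝟙 P - s)⟦(1 : ℤ)⟧' = 0 := comp_distTriang_mor_zero₃₁ _ hT
    rw [Category.assoc, this, comp_zero]
  have h₂ : (y ≫ b) ≫ s⟦(1 : ℤ)⟧' = 0 :=
    FactorsThroughFamily.comp_eq_zero (hS.factors Y hY)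
      (isColimitCofanMkObjOfIsColimit (shiftFunctor T (1 : ℤ)) _ _ hP)
      _ (fun i Z hZ f => by rw [← Functor.map_comp]; exact hs₁ i Z hZ f) _
  rw [Functor.map_sub, Preadditive.comp_sub, h₂, sub_zero, CategoryTheory.Functor.map_id,
    Category.comp_id] at h₁
  obtain ⟨z, rfl⟩ : ∃ z : Y ⟶ P, y = z ≫ a := Triangle.coyoneda_exact₃ _ hT y h₁
  have h₃ : z ≫ s = 0 :=
    FactorsThroughFamily.comp_eq_zero (hS.factors Y hY) hP _ hs₀ _
  have h₄ : z = z ≫ (𝟙 P - s) := by rw [Preadditive.comp_sub, h₃, Category.comp_id, sub_zero]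
  have h₅ : (𝟙 P - s) ≫ a = 0 := comp_distTriang_mor_zero₁₂ _ hT
  rw [h₄, Category.assoc, h₅, comp_zero]

end Triangulated

section

variable {V : Type u} [Category.{v} V] [Preadditive V] {ι : Type*} (c : ComplexShape ι)

section

variable {I : Type w} {F : I → HomologicalComplex V c} {P : HomologicalComplex V c}
  {g : ∀ i, F i ⟶ P}

theorem exists_quotient_desc (hP : IsColimit (Cofan.mk P g)) {Q : HomotopyCategory V c}
    (φ : ∀ i, (HomotopyCategory.quotient V c).obj (F i) ⟶ Q) :
    ∃ m : (HomotopyCategory.quotient V c).obj P ⟶ Q,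
      ∀ i, (HomotopyCategory.quotient V c).map (g i) ≫ m = φ i := by
  obtain ⟨Q, rfl⟩ := Q.quotient_obj_surjective
  choose ψ hψ using fun i => (HomotopyCategory.quotient V c).map_surjective (φ i)
  refine ⟨(HomotopyCategory.quotient V c).map (Cofan.IsColimit.desc hP ψ), fun i => ?_⟩
  rw [← Functor.map_comp, ← hψ]
  exact congrArg _ (Cofan.IsColimit.fac hP ψ i)

theorem quotient_hom_ext (hP : ∀ n, IsColimit (Cofan.mk (P.X n) fun i => (g i).f n))
    {Q : HomotopyCategory V c} (m m' : (HomotopyCategory.quotient V c).obj P ⟶ Q)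
    (h : ∀ i, (HomotopyCategory.quotient V c).map (g i) ≫ m =
      (HomotopyCategory.quotient V c).map (g i) ≫ m') : m = m' := by
  obtain ⟨Q, rfl⟩ := Q.quotient_obj_surjective
  obtain ⟨m, rfl⟩ := (HomotopyCategory.quotient V c).map_surjective m
  obtain ⟨m', rfl⟩ := (HomotopyCategory.quotient V c).map_surjective m'
  simp only [← Functor.map_comp] at h
  let H (i) : Homotopy (g i ≫ m) (g i ≫ m') := HomotopyCategory.homotopyOfEq _ _ (h i)
  let K (a b : ι) : P.X a ⟶ Q.X b := Cofan.IsColimit.desc (hP a) fun i => (H i).hom a b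
  have hK (i a b) : (g i).f a ≫ K a b = (H i).hom a b := Cofan.IsColimit.fac (hP a) _ i
  refine HomotopyCategory.eq_of_homotopy _ _ ⟨K, fun a b hab => ?_, fun a => ?_⟩
  · refine Cofan.IsColimit.hom_ext (hP a) _ _ fun i => (hK i a b).trans ?_
    rw [(H i).zero a b hab, comp_zero]
  · refine Cofan.IsColimit.hom_ext (hP a) _ _ fun i => ?_
    have h1 := (H i).comm a
    have h2 : (H i).hom = fun a b => (g i).f a ≫ K a b := by
      ext1 a; ext1 b; exact (hK i a b).symm
    rw [h2, dNext_comp_left, prevD_comp_left] at h1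
    simpa [Cofan.inj] using h1

/-- A coproduct of complexes, computed degreewise, is a coproduct in the homotopy category. -/
noncomputable def isColimitQuotientCofan (hP : IsColimit (Cofan.mk P g))
    (hP' : ∀ n, IsColimit (Cofan.mk (P.X n) fun i => (g i).f n)) :
    IsColimit (Cofan.mk ((HomotopyCategory.quotient V c).obj P)
      fun i => (HomotopyCategory.quotient V c).map (g i)) :=
  Cofan.IsColimit.mk _ (fun t => (exists_quotient_desc c hP t.inj).choose)
    (fun t => (exists_quotient_desc c hP t.inj).choose_spec)
    (fun t _ hm => quotient_hom_ext c hP' _ _ fun i =>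
      (hm i).trans ((exists_quotient_desc c hP t.inj).choose_spec i).symm)

end

end

end LocWellGen

namespace LocWellGen

open CategoryTheory CategoryTheory.Limits CategoryTheory.Pretriangulated CochainComplex
  HomologicalComplex

universe u

section

variable {S : Type u} [Ring S] (U : Type u) [AddCommGroup U] [Module S U]

/-- The morphisms of modules which factor through a direct sum of copies of `U`. -/
def FactorsThroughAdd {M N : ModuleCat.{u} S} (f : M ⟶ N) : Prop :=
  ∃ (I : Type u) (a : M ⟶ ModuleCat.of S (I →₀ U)) (b : ModuleCat.of S (I →₀ U) ⟶ N), a ≫ b = f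

namespace FactorsThroughAdd

variable {U} {M N L : ModuleCat.{u} S}

theorem comp_left {g : M ⟶ N} (hg : FactorsThroughAdd U g) (f : L ⟶ M) :
    FactorsThroughAdd U (f ≫ g) := by
  obtain ⟨I, a, b, rfl⟩ := hg
  exact ⟨I, f ≫ a, b, Category.assoc _ _ _⟩

theorem comp_right {g : M ⟶ N} (hg : FactorsThroughAdd U g) (f : N ⟶ L) :
    FactorsThroughAdd U (g ≫ f) := by
  obtain ⟨I, a, b, rfl⟩ := hg
  exact ⟨I, a, b ≫ f, (Category.assoc _ _ _).symm⟩

theorem of_id_left (h : FactorsThroughAdd U (𝟙 M)) (f : M ⟶ N) : FactorsThroughAdd U f := by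
  simpa using h.comp_right f

theorem desc {K : Type u} {F : K → ModuleCat.{u} S} {g : ∀ k, F k ⟶ M}
    (hM : IsColimit (Cofan.mk M g)) {f : M ⟶ N} (hf : ∀ k, FactorsThroughAdd U (g k ≫ f)) :
    FactorsThroughAdd U f := by
  choose I a b hab using hf
  refine ⟨Σ k, I k, Cofan.IsColimit.desc hM fun k =>
      a k ≫ ModuleCat.ofHom (Finsupp.lmapDomain U S (Sigma.mk k)),
    ModuleCat.ofHom (Finsupp.lsum ℕ fun p : Σ k, I k => (b p.1).hom ∘ₗ Finsupp.lsingle p.2), ?_⟩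
  refine Cofan.IsColimit.hom_ext hM _ _ fun k => ?_
  rw [Cofan.IsColimit.fac_assoc, Category.assoc]
  refine Eq.trans ?_ (hab k)
  congr 1
  ext i u
  simp

theorem add {f g : M ⟶ N} (hf : FactorsThroughAdd U f) (hg : FactorsThroughAdd U g) :
    FactorsThroughAdd U (f + g) := by
  obtain ⟨I, a, b, rfl⟩ := hf
  obtain ⟨J, a', b', rfl⟩ := hg
  let e := Finsupp.sumFinsuppLEquivProdFinsupp (α := I) (β := J) (M := U) S
  refine ⟨I ⊕ J, ModuleCat.ofHom (e.symm.toLinearMap ∘ₗ a.hom.prod a'.hom),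
    ModuleCat.ofHom (b.hom.coprod b'.hom ∘ₗ e.toLinearMap), ?_⟩
  ext m
  simp

end FactorsThroughAdd

theorem factorsThroughAdd_id_directSum {J : Type u} (M : J → ModuleCat.{u} S) (j : J) :
    FactorsThroughAdd (DirectSum J fun j => M j) (𝟙 (M j)) := by
  classical
  refine ⟨PUnit, ModuleCat.ofHom (Finsupp.lsingle PUnit.unit ∘ₗ DirectSum.lof S J (fun j => M j) j),
    ModuleCat.ofHom (DirectSum.component S J (fun j => M j) j ∘ₗ Finsupp.lapply PUnit.unit), ?_⟩
  ext m
  simp [DirectSum.component.lof_self]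

end

section

variable {S : Type u} [Ring S] {J : Type u} (G : J → CochainComplex (ModuleCat.{u} S) ℤ)
  (X : CochainComplex (ModuleCat.{u} S) ℤ)

/-- The coproduct of all the morphisms from the complexes `G j` to `X`, up to homotopy. -/
noncomputable def totalEval :
    (∐ fun p : Σ j, ((HomotopyCategory.quotient _ _).obj (G j) ⟶
      (HomotopyCategory.quotient _ _).obj X) => G p.1) ⟶ X :=
  Sigma.desc fun p => ((HomotopyCategory.quotient _ _).map_surjective p.2).choose

/-- The complex obtained from `X` by killing all the morphisms from the complexes `G j`. -/
noncomputable def kill : CochainComplex (ModuleCat.{u} S) ℤ := mappingCone (totalEval G X)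

/-- The canonical inclusion. -/
noncomputable def toKill : X ⟶ kill G X := mappingCone.inr (totalEval G X)

/-- The degreewise retraction of `toKill`. -/
noncomputable def killTo (n : ℤ) : (kill G X).X n ⟶ X.X n :=
  (mappingCone.snd (totalEval G X)).v n n (add_zero n)

theorem toKill_killTo (n : ℤ) : (toKill G X).f n ≫ killTo G X n = 𝟙 _ :=
  mappingCone.inr_f_snd_v _ _

theorem comp_quotient_map_toKill (j : J)
    (f : (HomotopyCategory.quotient _ _).obj (G j) ⟶ (HomotopyCategory.quotient _ _).obj X) :
    f ≫ (HomotopyCategory.quotient _ _).map (toKill G X) = 0 := by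
  have h : f = (HomotopyCategory.quotient _ _).map (Sigma.ι (fun p : Σ j,
      ((HomotopyCategory.quotient _ _).obj (G j) ⟶
        (HomotopyCategory.quotient _ _).obj X) => G p.1) ⟨j, f⟩) ≫
      (HomotopyCategory.quotient _ _).map (totalEval G X) := by
    rw [← Functor.map_comp, totalEval, Sigma.ι_desc]
    exact ((HomotopyCategory.quotient _ _).map_surjective f).choose_spec.symm
  have h' : (HomotopyCategory.quotient _ _).map (totalEval G X) ≫
      (HomotopyCategory.quotient _ _).map (toKill G X) = 0 :=
    comp_distTriang_mor_zero₁₂ _ (HomotopyCategory.mappingCone_triangleh_distinguished _)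
  rw [h, Category.assoc, h', comp_zero]

variable {U : Type u} [AddCommGroup U] [Module S U]

theorem factorsThroughAdd_d_killTo (hU : ∀ j n, FactorsThroughAdd U (𝟙 ((G j).X n)))
    {A : ModuleCat.{u} S} {m n : ℤ} (hmn : m + 1 = n) (g : X.X n ⟶ A)
    (hg : FactorsThroughAdd U (X.d m n ≫ g)) :
    FactorsThroughAdd U ((kill G X).d m n ≫ killTo G X n ≫ g) := by
  obtain ⟨a, b, h⟩ : ∃ (a : (kill G X).X m ⟶ _) (b : (kill G X).X m ⟶ X.X m),
      (kill G X).d m n ≫ killTo G X n =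
      a ≫ (totalEval G X).f n + b ≫ X.d m n :=
    ⟨_, _, mappingCone.d_snd_v (totalEval G X) m n hmn⟩
  rw [reassoc_of% h, Preadditive.add_comp, Category.assoc, Category.assoc]
  refine .add (.comp_left (.desc (isColimitCofanMkObjOfIsColimit
    (HomologicalComplex.eval _ _ n) _ _ (coproductIsCoproduct _)) fun p => ?_) _) (hg.comp_left _)
  exact (hU p.1 n).of_id_left _

end

section

variable {S : Type u} [Ring S] {J : Type u} (G : J → CochainComplex (ModuleCat.{u} S) ℤ)
  (A : ModuleCat.{u} S)

/-- The complexes obtained from `A` by iteratively killing the morphisms from the `G j`. -/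
noncomputable def killSeq : ℕ → CochainComplex (ModuleCat.{u} S) ℤ
  | 0 => (HomologicalComplex.single _ _ 0).obj A
  | n + 1 => kill G (killSeq n)

/-- The retraction onto `A` in degree zero. -/
noncomputable def killSeqTo : ∀ n, (killSeq G A n).X 0 ⟶ A
  | 0 => (HomologicalComplex.singleObjXSelf (ComplexShape.up ℤ) 0 A).hom
  | n + 1 => killTo G (killSeq G A n) 0 ≫ killSeqTo n

/-- The transition morphisms. -/
noncomputable def killSeqMap (n : ℕ) : killSeq G A n ⟶ killSeq G A (n + 1) :=
  toKill G (killSeq G A n)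

theorem killSeqMap_killSeqTo (n : ℕ) :
    (killSeqMap G A n).f 0 ≫ killSeqTo G A (n + 1) = killSeqTo G A n := by
  have h := toKill_killTo G (killSeq G A n) 0
  exact (reassoc_of% h) (killSeqTo G A n)

variable {U : Type u} [AddCommGroup U] [Module S U]

theorem FactorsThroughAdd.zero {M N : ModuleCat.{u} S} :
    FactorsThroughAdd U (0 : M ⟶ N) := ⟨PEmpty, 0, 0, by simp⟩

theorem factorsThroughAdd_d_killSeqTo (hU : ∀ j n, FactorsThroughAdd U (𝟙 ((G j).X n))) :
    ∀ n, FactorsThroughAdd U ((killSeq G A n).d (-1) 0 ≫ killSeqTo G A n)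
  | 0 => by
    have : (killSeq G A 0).d (-1) 0 = 0 := HomologicalComplex.single_obj_d _ _ _ _ _
    rw [this, zero_comp]
    exact .zero
  | n + 1 => factorsThroughAdd_d_killTo G _ hU (by simp) _ (factorsThroughAdd_d_killSeqTo hU n)

/-- The coproduct of the complexes `killSeq G A n`. -/
noncomputable def killTot : CochainComplex (ModuleCat.{u} S) ℤ :=
  ∐ fun n : ULift.{u} ℕ => killSeq G A n.down

/-- The inclusions. -/
noncomputable def killTotι (n : ℕ) : killSeq G A n ⟶ killTot G A :=
  Sigma.ι (fun n : ULift.{u} ℕ => killSeq G A n.down) ⟨n⟩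

/-- `killTot` is a coproduct. -/
noncomputable def killTotIsColimit :
    IsColimit (Cofan.mk (killTot G A) fun n : ULift.{u} ℕ => killTotι G A n.down) :=
  coproductIsCoproduct _

/-- `killTot` is a degreewise coproduct. -/
noncomputable def killTotIsColimitX (m : ℤ) :
    IsColimit (Cofan.mk ((killTot G A).X m) fun n : ULift.{u} ℕ => (killTotι G A n.down).f m) :=
  isColimitCofanMkObjOfIsColimit (HomologicalComplex.eval _ _ m) _ _ (killTotIsColimit G A)

/-- The shift endomorphism of `killTot`. -/
noncomputable def killTotShift : killTot G A ⟶ killTot G A :=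
  Cofan.IsColimit.desc (killTotIsColimit G A) fun n =>
    killSeqMap G A n.down ≫ killTotι G A (n.down + 1)

theorem killTotι_shift (n : ℕ) :
    killTotι G A n ≫ killTotShift G A = killSeqMap G A n ≫ killTotι G A (n + 1) :=
  Cofan.IsColimit.fac (killTotIsColimit G A) _ ⟨n⟩

/-- The retraction onto `A` in degree zero. -/
noncomputable def killTotTo : (killTot G A).X 0 ⟶ A :=
  Cofan.IsColimit.desc (killTotIsColimitX G A 0) fun n => killSeqTo G A n.down

theorem killTotι_to (n : ℕ) :
    (killTotι G A n).f 0 ≫ killTotTo G A = killSeqTo G A n :=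
  Cofan.IsColimit.fac (killTotIsColimitX G A 0) _ ⟨n⟩

theorem killTotShift_to : (killTotShift G A).f 0 ≫ killTotTo G A = killTotTo G A := by
  refine Cofan.IsColimit.hom_ext (killTotIsColimitX G A 0) _ _ fun ⟨n⟩ => ?_
  change (killTotι G A n).f 0 ≫ _ = (killTotι G A n).f 0 ≫ _
  have := congrArg (fun f => f.f 0) (killTotι_shift G A n)
  simp only [HomologicalComplex.comp_f] at this
  rw [reassoc_of% this, killTotι_to, killTotι_to, killSeqMap_killSeqTo]

theorem factorsThroughAdd_d_killTotTo (hU : ∀ j n, FactorsThroughAdd U (𝟙 ((G j).X n))) :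
    FactorsThroughAdd U ((killTot G A).d (-1) 0 ≫ killTotTo G A) := by
  refine .desc (killTotIsColimitX G A (-1)) fun ⟨n⟩ => ?_
  change FactorsThroughAdd U ((killTotι G A n).f (-1) ≫ _)
  rw [HomologicalComplex.Hom.comm_assoc, killTotι_to]
  exact factorsThroughAdd_d_killSeqTo G A hU n

theorem factorsThroughAdd_id_of_isIso (hU : ∀ j n, FactorsThroughAdd U (𝟙 ((G j).X n)))
    (h : IsIso ((HomotopyCategory.quotient _ (ComplexShape.up ℤ)).map
      (𝟙 (killTot G A) - killTotShift G A))) :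
    FactorsThroughAdd U (𝟙 A) := by
  obtain ⟨t, ht⟩ := (HomotopyCategory.quotient _ _).map_surjective (inv
    ((HomotopyCategory.quotient _ (ComplexShape.up ℤ)).map (𝟙 (killTot G A) - killTotShift G A)))
  have H : Homotopy (𝟙 (killTot G A)) (t ≫ (𝟙 (killTot G A) - killTotShift G A)) := by
    refine HomotopyCategory.homotopyOfEq _ _ ?_
    rw [Functor.map_comp, ht, IsIso.inv_hom_id, CategoryTheory.Functor.map_id]
  have h₁ := H.comm 0
  rw [dNext_eq H.hom (show (ComplexShape.up ℤ).Rel 0 1 by simp),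
    prevD_eq H.hom (show (ComplexShape.up ℤ).Rel (-1) 0 by simp)] at h₁
  have h₂ : (killTotι G A 0).f 0 ≫ (killTot G A).d 0 1 = 0 := by
    rw [HomologicalComplex.Hom.comm]
    have : (killSeq G A 0).d 0 1 = 0 := HomologicalComplex.single_obj_d _ _ _ _ _
    rw [this, zero_comp]
  have h₃ : (𝟙 (killTot G A) - killTotShift G A).f 0 ≫ killTotTo G A = 0 := by
    rw [HomologicalComplex.sub_f_apply, Preadditive.sub_comp, killTotShift_to,
      HomologicalComplex.id_f, Category.id_comp, sub_self]
  obtain ⟨i, hi⟩ : ∃ i : A ⟶ (killSeq G A 0).X 0, i ≫ killSeqTo G A 0 = 𝟙 A :=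
    ⟨_, (HomologicalComplex.singleObjXSelf (ComplexShape.up ℤ) 0 A).inv_hom_id⟩
  have h₄ : 𝟙 A = i ≫ (killTotι G A 0).f 0 ≫ (𝟙 (killTot G A) : _ ⟶ _).f 0 ≫ killTotTo G A := by
    rw [HomologicalComplex.id_f, Category.id_comp, killTotι_to, hi]
  have h₅ : 𝟙 A = i ≫ (killTotι G A 0).f 0 ≫ H.hom 0 (-1) ≫
      (killTot G A).d (-1) 0 ≫ killTotTo G A := by
    rw [h₄, h₁]
    simp only [Preadditive.add_comp, Preadditive.comp_add, Category.assoc,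
      HomologicalComplex.comp_f, h₃, comp_zero, add_zero, reassoc_of% h₂, zero_comp, zero_add]
  rw [h₅]
  exact (((factorsThroughAdd_d_killTotTo G A hU).comp_left _).comp_left _).comp_left _

/-- If the shifts of the objects of a generating class are among the `G j`, then every module is
a direct summand of a direct sum of copies of `U`. -/
theorem factorsThroughAdd_id_of_generatesWell
    {𝒮 : Set (HomotopyCategory (ModuleCat.{u} S) (ComplexShape.up ℤ))} {κ : Cardinal.{u}}
    (h𝒮 : GeneratesWell _ Set.univ κ 𝒮)
    (hG₀ : ∀ Y ∈ 𝒮, ∃ j, Nonempty ((HomotopyCategory.quotient _ _).obj (G j) ≅ Y))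
    (hG₁ : ∀ Y ∈ 𝒮, ∃ j, Nonempty ((HomotopyCategory.quotient _ _).obj (G j) ≅ Y⟦(-1 : ℤ)⟧))
    (hU : ∀ j n, FactorsThroughAdd U (𝟙 ((G j).X n))) :
    FactorsThroughAdd U (𝟙 A) := by
  have key {Y : HomotopyCategory (ModuleCat.{u} S) (ComplexShape.up ℤ)}
      (hY : ∃ j, Nonempty ((HomotopyCategory.quotient _ _).obj (G j) ≅ Y)) (n : ℕ)
      (f : Y ⟶ (HomotopyCategory.quotient _ _).obj (killSeq G A n)) :
      f ≫ (HomotopyCategory.quotient _ _).map (killSeqMap G A n) = 0 := by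
    obtain ⟨j, ⟨e⟩⟩ := hY
    rw [← cancel_epi e.hom, comp_zero, ← Category.assoc]
    exact comp_quotient_map_toKill G _ j _
  refine factorsThroughAdd_id_of_isIso G A hU ?_
  rw [Functor.map_sub, CategoryTheory.Functor.map_id]
  refine h𝒮.isIso_id_sub (isColimitQuotientCofan _ (killTotIsColimit G A)
    (killTotIsColimitX G A)) _ (fun ⟨n⟩ Y hY f => ?_) (fun ⟨n⟩ Y hY f => ?_)
  · rw [← Functor.map_comp, killTotι_shift, Functor.map_comp, reassoc_of% key (hG₀ Y hY) n f,
      zero_comp]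
  · rw [← Functor.map_comp, killTotι_shift, Functor.map_comp, Functor.map_comp]
    have : f ≫ ((HomotopyCategory.quotient _ _).map (killSeqMap G A n))⟦(1 : ℤ)⟧' = 0 := by
      apply (CategoryTheory.shiftFunctor (HomotopyCategory (ModuleCat.{u} S) (ComplexShape.up ℤ))
        (-1 : ℤ)).map_injective
      rw [Functor.map_comp, Functor.map_zero, shift_shift_neg']
      have := key (hG₁ Y hY) n (f⟦(-1 : ℤ)⟧' ≫
        (shiftFunctorCompIsoId _ (1 : ℤ) (-1) (by simp)).hom.app _)
      rw [Category.assoc] at this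
      rw [reassoc_of% this, zero_comp]
    rw [reassoc_of% this, zero_comp]

/-- If the homotopy category of complexes is well generated, then there is a module such that
every module is a direct summand of a direct sum of copies of it. -/
theorem exists_factorsThroughAdd_id (S : Type u) [Ring S]
    (h : IsWellGenerated (HomotopyCategory (ModuleCat.{u} S) (ComplexShape.up ℤ))) :
    ∃ U : ModuleCat.{u} S, ∀ A : ModuleCat.{u} S, FactorsThroughAdd U (𝟙 A) := by
  obtain ⟨κ, -, 𝒮, h𝒮⟩ := h
  have := h𝒮.isSmall
  let G : Shrink.{u} 𝒮 × ULift.{u} Bool → CochainComplex (ModuleCat.{u} S) ℤ := fun p =>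
    if p.2.down then ((equivShrink 𝒮).symm p.1).1.as
    else (((equivShrink 𝒮).symm p.1).1⟦(-1 : ℤ)⟧).as
  refine ⟨ModuleCat.of S (DirectSum ((Shrink.{u} 𝒮 × ULift.{u} Bool) × ULift.{u} ℤ)
    fun p => (G p.1).X p.2.down), fun A =>
    factorsThroughAdd_id_of_generatesWell G A h𝒮 (fun Y hY => ?_) (fun Y hY => ?_) fun j n => ?_⟩
  · refine ⟨⟨equivShrink 𝒮 ⟨Y, hY⟩, ⟨true⟩⟩, ⟨eqToIso ?_⟩⟩
    simp [G]
    rfl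
  · refine ⟨⟨equivShrink 𝒮 ⟨Y, hY⟩, ⟨false⟩⟩, ⟨eqToIso ?_⟩⟩
    simp [G]
    rfl
  · exact factorsThroughAdd_id_directSum (fun p : (Shrink.{u} 𝒮 × ULift.{u} Bool) × ULift.{u} ℤ =>
      (G p.1).X p.2.down) (j, ⟨n⟩)

end

end LocWellGen

namespace LocWellGen

open CategoryTheory CategoryTheory.Limits CategoryTheory.Pretriangulated

universe v u

section Compact

variable {T : Type u} [Category.{v} T] [Preadditive T]

/-- Every morphism from `Y` to a coproduct is a finite sum of morphisms to the summands. -/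
def IsCompactObj (Y : T) : Prop :=
  ∀ {I : Type v} (X : I → T) (c : Cofan X), IsColimit c → ∀ f : Y ⟶ c.pt,
    ∃ (J : Finset I) (g : ∀ i, Y ⟶ X i), f = ∑ i ∈ J, g i ≫ c.inj i


theorem IsCompactObj.isKappaSmall {Y : T} (hY : IsCompactObj Y)
    (hT : ∀ {I : Type v} (X : I → T), ∃ c : Cofan X, Nonempty (IsColimit c)) (L : Set T) :
    IsKappaSmall T L Cardinal.aleph0 Y := by
  intro I X _ c hc f
  obtain ⟨J, g, rfl⟩ := hY X c hc f
  obtain ⟨c', ⟨hc'⟩⟩ := hT fun j : (J : Set I) => X j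
  refine ⟨J, c', hc', ∑ j : (J : Set I), g j.1 ≫ c'.inj j, Cardinal.mk_lt_aleph0, ?_⟩
  rw [Preadditive.sum_comp, ← Finset.sum_coe_sort]
  refine Finset.sum_congr rfl fun j _ => ?_
  rw [Category.assoc]
  exact congrArg _ (hc'.fac (Cofan.mk c.pt fun j : (J : Set I) => c.inj j.1) ⟨j⟩).symm

theorem IsCompactObj.factorsThroughFamily {Y : T} (hY : IsCompactObj Y)
    (hT : ∀ {I : Type v} (X : I → T), ∃ c : Cofan X, Nonempty (IsColimit c)) (L : Set T)
    {S : Set T} (hYS : Y ∈ S) : FactorsThroughFamily T L S Y := by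
  intro I X _ c hc f
  obtain ⟨J, g, rfl⟩ := hY X c hc f
  obtain ⟨cz, ⟨hcz⟩⟩ := hT fun _ : I => Y
  refine ⟨fun _ => Y, fun _ => hYS, g, cz, hcz, ∑ j ∈ J, cz.inj j, ?_⟩
  rw [Preadditive.sum_comp]
  refine Finset.sum_congr rfl fun j _ => ?_
  exact (hcz.fac (Cofan.mk c.pt fun i => g i ≫ c.inj i) ⟨j⟩).symm

end Compact

section

variable {S : Type u} [Ring S]

/-- Every morphism from a finitely generated module to the degree `n` part of a coproduct of
complexes is a finite sum of its components. -/
theorem exists_finset_eq_sum {I : Type u} {F : I → CochainComplex (ModuleCat.{u} S) ℤ}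
    {C : CochainComplex (ModuleCat.{u} S) ℤ} {g : ∀ i, F i ⟶ C} (hC : IsColimit (Cofan.mk C g))
    (P : Type u) [AddCommGroup P] [Module S P] [Module.Finite S P] (n : ℤ)
    (x : ModuleCat.of S P ⟶ C.X n) :
    ∃ (J : Finset I) (π : ∀ i, C ⟶ F i), x = ∑ i ∈ J, x ≫ (π i).f n ≫ (g i).f n := by
  classical
  let π (i : I) : C ⟶ F i := Cofan.IsColimit.desc hC fun j =>
    if h : j = i then eqToHom (congrArg F h) else 0
  have hπ (i j : I) : g j ≫ π i = if h : j = i then eqToHom (congrArg F h) else 0 :=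
    Cofan.IsColimit.fac hC _ j
  have hπ₁ (i : I) : g i ≫ π i = 𝟙 _ := by simp [hπ]
  have hπ₂ (i j : I) (h : j ≠ i) : g j ≫ π i = 0 := by simp [hπ, h]
  let t (i : I) : C.X n →ₗ[S] C.X n := ((π i).f n ≫ (g i).f n).hom
  let N : Submodule S (C.X n) :=
    { carrier := {z | ∃ J : Finset I, ∀ J', J ⊆ J' → ∑ i ∈ J', t i z = z}
      add_mem' := by
        rintro a b ⟨J, hJ⟩ ⟨J', hJ'⟩
        refine ⟨J ∪ J', fun K hK => ?_⟩
        simp only [map_add, Finset.sum_add_distrib, hJ K (Finset.union_subset_left hK),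
          hJ' K (Finset.union_subset_right hK)]
      zero_mem' := ⟨∅, by simp⟩
      smul_mem' := by
        rintro r a ⟨J, hJ⟩
        exact ⟨J, fun K hK => by simp only [map_smul, ← Finset.smul_sum, hJ K hK]⟩ }
  have hN : N = ⊤ := by
    have hq : ModuleCat.ofHom N.mkQ = 0 := by
      let hC' : IsColimit (Cofan.mk (C.X n) fun i => (g i).f n) :=
        isColimitCofanMkObjOfIsColimit (HomologicalComplex.eval _ _ n) _ _ hC
      refine Cofan.IsColimit.hom_ext hC' _ _ fun j => ?_
      change (g j).f n ≫ _ = (g j).f n ≫ _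
      rw [comp_zero]
      ext y
      refine (Submodule.Quotient.mk_eq_zero N).2 ⟨{j}, fun K hK => ?_⟩
      have h₀ (i : I) : t i ((g j).f n y) = ((g j ≫ π i) ≫ g i).f n y := by simp [t]
      change ∑ i ∈ K, t i ((g j).f n y) = (g j).f n y
      rw [Finset.sum_eq_single_of_mem j (Finset.singleton_subset_iff.1 hK), h₀, hπ₁,
        Category.id_comp]
      intro i _ hij
      rw [h₀, hπ₂ i j hij.symm, zero_comp]
      rfl
    rw [← N.ker_mkQ, LinearMap.ker_eq_top]
    exact congrArg ModuleCat.Hom.hom hq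
  have hmem (z : C.X n) : z ∈ N := hN ▸ Submodule.mem_top
  choose J hJ using hmem
  obtain ⟨G, hG⟩ := Module.Finite.fg_top (R := S) (M := P)
  refine ⟨G.biUnion fun p => J (x.hom p), π, ?_⟩
  ext1
  refine LinearMap.ext_on hG fun p hp => ?_
  have := hJ (x.hom p) (G.biUnion fun p => J (x.hom p))
    (Finset.subset_biUnion_of_mem (fun p => J (x.hom p)) hp)
  refine this.symm.trans ?_
  simp [t, ModuleCat.hom_sum]

theorem exists_isColimit_cofan {I : Type u}
    (X : I → HomotopyCategory (ModuleCat.{u} S) (ComplexShape.up ℤ)) :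
    ∃ c : Cofan X, Nonempty (IsColimit c) :=
  ⟨_, ⟨isColimitQuotientCofan _ (coproductIsCoproduct fun i => (X i).as)
    fun n => isColimitCofanMkObjOfIsColimit (HomologicalComplex.eval _ _ n) _ _
      (coproductIsCoproduct _)⟩⟩

theorem isCompactObj_quotient_single (P : Type u) [AddCommGroup P] [Module S P]
    [Module.Finite S P] (n : ℤ) :
    IsCompactObj ((HomotopyCategory.quotient (ModuleCat.{u} S) (ComplexShape.up ℤ)).obj
      ((HomologicalComplex.single _ _ n).obj (ModuleCat.of S P))) := by
  intro I X c hc f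
  obtain ⟨F, rfl⟩ : ∃ F : I → CochainComplex (ModuleCat.{u} S) ℤ,
      X = fun i => (HomotopyCategory.quotient _ _).obj (F i) := ⟨fun i => (X i).as, rfl⟩
  let hF := isColimitQuotientCofan _ (coproductIsCoproduct F)
    fun n => isColimitCofanMkObjOfIsColimit (HomologicalComplex.eval _ _ n) _ _
      (coproductIsCoproduct F)
  obtain ⟨a, b, hab, hb⟩ : ∃ (a : c.pt ⟶ (HomotopyCategory.quotient _ _).obj (∐ F))
      (b : (HomotopyCategory.quotient _ _).obj (∐ F) ⟶ c.pt), a ≫ b = 𝟙 _ ∧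
      ∀ i, (HomotopyCategory.quotient _ _).map (Sigma.ι F i) ≫ b = c.inj i := by
    refine ⟨(hc.coconePointUniqueUpToIso hF).hom, (hc.coconePointUniqueUpToIso hF).inv,
      Iso.hom_inv_id _, fun i => ?_⟩
    exact hc.comp_coconePointUniqueUpToIso_inv hF ⟨i⟩
  obtain ⟨φ, hφ⟩ := (HomotopyCategory.quotient _ _).map_surjective (f ≫ a)
  obtain ⟨J, π, h⟩ := exists_finset_eq_sum (coproductIsCoproduct F) P n
    ((HomologicalComplex.singleObjXSelf _ n _).inv ≫ φ.f n)
  have h' : φ = ∑ i ∈ J, φ ≫ π i ≫ Sigma.ι F i := by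
    refine HomologicalComplex.from_single_hom_ext ?_
    rw [← cancel_epi (HomologicalComplex.singleObjXSelf _ n _).inv, h]
    have hs : (∑ i ∈ J, φ ≫ π i ≫ Sigma.ι F i).f n =
        ∑ i ∈ J, φ.f n ≫ (π i).f n ≫ (Sigma.ι F i).f n :=
      ((HomologicalComplex.eval _ _ n).map_sum _ _).trans rfl
    simp only [hs, Preadditive.comp_sum, Category.assoc]
  have h'' : f = (HomotopyCategory.quotient _ _).map (∑ i ∈ J, φ ≫ π i ≫ Sigma.ι F i) ≫ b := by
    rw [← h', hφ, Category.assoc, hab, Category.comp_id]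
  refine ⟨J, fun i => (HomotopyCategory.quotient _ _).map (φ ≫ π i), ?_⟩
  rw [h'', Functor.map_sum, Preadditive.sum_comp]
  refine Finset.sum_congr rfl fun i _ => ?_
  rw [← hb, ← Category.assoc φ, Functor.map_comp, Category.assoc]

end

section

variable {S : Type u} [Ring S]

theorem exists_section_of_ker_retraction {M N : Type u} [AddCommGroup M] [AddCommGroup N]
    [Module S M] [Module S N] (d : M →ₗ[S] N) (r : M →ₗ[S] LinearMap.ker d)
    (hr : r.comp (LinearMap.ker d).subtype = LinearMap.id) :
    ∃ σ : LinearMap.range d →ₗ[S] M, ∀ x y, d x = y.1 → σ y = x - r x := by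
  refine ⟨(LinearMap.ker d).liftQ (LinearMap.id - (LinearMap.ker d).subtype ∘ₗ r) ?_ ∘ₗ
    d.quotKerEquivRange.symm.toLinearMap, ?_⟩
  · intro x hx
    have : r x = ⟨x, hx⟩ := LinearMap.congr_fun hr ⟨x, hx⟩
    simp [this]
  · rintro x ⟨y, hy⟩ (rfl : d x = y)
    have : d.quotKerEquivRange.symm ⟨d x, hy⟩ = (LinearMap.ker d).mkQ x := by
      rw [LinearEquiv.symm_apply_eq]
      ext
      simp
    simp [this]

/-- An acyclic complex in which all the cycles are direct summands is contractible. -/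
theorem nonempty_homotopy_id_zero (C : CochainComplex (ModuleCat.{u} S) ℤ)
    (hC : ∀ i j k : ℤ, i + 1 = j → j + 1 = k →
      LinearMap.range (C.d i j).hom = LinearMap.ker (C.d j k).hom)
    (r : ∀ i j : ℤ, i + 1 = j → C.X i →ₗ[S] LinearMap.ker (C.d i j).hom)
    (hr : ∀ i j h, (r i j h).comp (LinearMap.ker (C.d i j).hom).subtype = LinearMap.id) :
    Nonempty (Homotopy (𝟙 C) 0) := by
  have hσ (i j : ℤ) (h : i + 1 = j) := exists_section_of_ker_retraction _ (r i j h) (hr i j h)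
  choose σ hσ using hσ
  let t (j i : ℤ) (h : (ComplexShape.up ℤ).Rel i j) : C.X j ⟶ C.X i :=
    ModuleCat.ofHom (σ i j h ∘ₗ
      (LinearEquiv.ofEq _ _ (hC i j (j + 1) h rfl).symm).toLinearMap ∘ₗ r j (j + 1) rfl)
  have ht : 𝟙 C = Homotopy.nullHomotopicMap' t := by
    ext n x
    obtain ⟨m, rfl⟩ : ∃ m, m + 1 = n := ⟨n - 1, by simp⟩
    rw [Homotopy.nullHomotopicMap'_f (show (ComplexShape.up ℤ).Rel m (m + 1) by simp)
      (show (ComplexShape.up ℤ).Rel (m + 1) (m + 1 + 1) by simp)]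
    have h₀ : r (m + 1 + 1) (m + 1 + 1 + 1) rfl ((C.d (m + 1) (m + 1 + 1)).hom x) =
        ⟨(C.d (m + 1) (m + 1 + 1)).hom x, hC _ _ _ rfl rfl ▸ ⟨x, rfl⟩⟩ :=
      LinearMap.congr_fun (hr _ _ rfl) ⟨_, _⟩
    have h₁ : (t (m + 1 + 1) (m + 1) rfl).hom ((C.d (m + 1) (m + 1 + 1)).hom x) =
        x - r (m + 1) (m + 1 + 1) rfl x := by
      refine hσ _ _ rfl _ _ ?_
      exact congrArg Subtype.val h₀.symm
    obtain ⟨z, hz⟩ : ∃ z, (C.d m (m + 1)).hom z = r (m + 1) (m + 1 + 1) rfl x :=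
      (hC m _ _ rfl rfl).ge (r (m + 1) (m + 1 + 1) rfl x).2
    have h₂ : (t (m + 1) m rfl).hom x = z - r m (m + 1) rfl z := hσ _ _ rfl _ _ hz
    have h₃ : (C.d m (m + 1)).hom ((t (m + 1) m rfl).hom x) = r (m + 1) (m + 1 + 1) rfl x := by
      rw [h₂, map_sub, hz, LinearMap.map_coe_ker, sub_zero]
    change x = (t (m + 1 + 1) (m + 1) rfl).hom ((C.d (m + 1) (m + 1 + 1)).hom x) +
      (C.d m (m + 1)).hom ((t (m + 1) m rfl).hom x)
    rw [h₁, h₃, sub_add_cancel]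
  rw [ht]
  exact ⟨Homotopy.nullHomotopy' t⟩

/-- If every morphism from a shift of `P` to a complex is null-homotopic, then `Hom(P, -)` is exact
on the complex. -/
theorem exists_comp_d_eq (C : CochainComplex (ModuleCat.{u} S) ℤ) (P : ModuleCat.{u} S) {i j k : ℤ}
    (hij : i + 1 = j) (hjk : j + 1 = k)
    (hC : ∀ f : (HomotopyCategory.quotient (ModuleCat.{u} S) (ComplexShape.up ℤ)).obj
      ((HomologicalComplex.single _ _ j).obj P) ⟶ (HomotopyCategory.quotient _ _).obj C, f = 0)
    (x : P ⟶ C.X j) (hx : x ≫ C.d j k = 0) : ∃ y : P ⟶ C.X i, y ≫ C.d i j = x := by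
  let f : (HomologicalComplex.single _ (ComplexShape.up ℤ) j).obj P ⟶ C :=
    HomologicalComplex.mkHomFromSingle x fun l hl => by
      obtain rfl : k = l := hjk.symm.trans hl
      exact hx
  have H : Homotopy f 0 := HomotopyCategory.homotopyOfEq _ _ (by simpa using hC _)
  have h := H.comm j
  rw [dNext_eq H.hom (show (ComplexShape.up ℤ).Rel j k from hjk),
    prevD_eq H.hom (show (ComplexShape.up ℤ).Rel i j from hij), HomologicalComplex.single_obj_d,
    HomologicalComplex.mkHomFromSingle_f, zero_comp, zero_add, HomologicalComplex.zero_f,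
    add_zero] at h
  refine ⟨(HomologicalComplex.singleObjXSelf (ComplexShape.up ℤ) j P).inv ≫ H.hom j i, ?_⟩
  rw [Category.assoc, ← h, Iso.inv_hom_id_assoc]

end

section

variable {R : Type u} [Ring R]

theorem isPureMono_ker_subtype {M N : Type u} [AddCommGroup M] [AddCommGroup N]
    [Module Rᵐᵒᵖ M] [Module Rᵐᵒᵖ N] (d : M →ₗ[Rᵐᵒᵖ] N)
    (hd : ∀ (P : Type u) [AddCommGroup P] [Module Rᵐᵒᵖ P], Module.FinitePresentation Rᵐᵒᵖ P →
      ∀ h : P →ₗ[Rᵐᵒᵖ] N, LinearMap.range h ≤ LinearMap.range d →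
        ∃ g : P →ₗ[Rᵐᵒᵖ] M, d.comp g = h) :
    IsPureMono R (LinearMap.ker d).subtype := by
  refine ⟨Subtype.val_injective, fun P _ _ hP h => ?_⟩
  have hle : LinearMap.range (LinearMap.ker d).subtype ≤ LinearMap.ker d := by simp
  let e := (LinearMap.range (LinearMap.ker d).subtype).liftQ d hle
  have he : Function.Injective e := by
    rw [← LinearMap.ker_eq_bot, Submodule.ker_liftQ_eq_bot]
    simp
  obtain ⟨g, hg⟩ := hd P hP (e ∘ₗ h) ((LinearMap.range_comp_le_range _ _).trans
    (by rw [Submodule.range_liftQ]))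
  refine ⟨g, LinearMap.ext fun p => he ?_⟩
  exact LinearMap.congr_fun hg p

/-- A small family of representatives of the finitely presented modules. -/
abbrev FPRep (S : Type u) [Ring S] : Type u := Σ k : ℕ, { N : Submodule S (Fin k → S) // N.FG }

/-- The module corresponding to a representative. -/
abbrev FPRep.toModule {S : Type u} [Ring S] (p : FPRep S) : Type u := (Fin p.1 → S) ⧸ p.2.1

/-- The stalk complexes of finitely presented modules. -/
def fpStalks (S : Type u) [Ring S] :
    Set (HomotopyCategory (ModuleCat.{u} S) (ComplexShape.up ℤ)) :=
  Set.range fun p : FPRep S × ℤ => (HomotopyCategory.quotient _ _).obj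
    ((HomologicalComplex.single _ _ p.2).obj (ModuleCat.of S p.1.toModule))

theorem exists_comp_d_eq_of_fpStalks {S : Type u} [Ring S] (C : CochainComplex (ModuleCat.{u} S) ℤ)
    (hC : ∀ Y ∈ fpStalks S, ∀ f : Y ⟶ (HomotopyCategory.quotient _ _).obj C, f = 0)
    (P : Type u) [AddCommGroup P] [Module S P] (hP : Module.FinitePresentation S P) {i j k : ℤ}
    (hij : i + 1 = j) (hjk : j + 1 = k) (x : P →ₗ[S] C.X j) (hx : (C.d j k).hom ∘ₗ x = 0) :
    ∃ y : P →ₗ[S] C.X i, (C.d i j).hom ∘ₗ y = x := by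
  obtain ⟨m, K, e, hK⟩ := Module.FinitePresentation.exists_fin S P
  obtain ⟨y, hy⟩ := exists_comp_d_eq C (ModuleCat.of S (FPRep.toModule ⟨m, K, hK⟩)) hij hjk
    (hC _ ⟨(⟨m, K, hK⟩, j), rfl⟩) (ModuleCat.ofHom (x ∘ₗ e.symm.toLinearMap)) (by
      ext1
      change ((C.d j k).hom ∘ₗ x) ∘ₗ e.symm.toLinearMap = 0
      rw [hx, LinearMap.zero_comp])
  refine ⟨y.hom ∘ₗ e.toLinearMap, LinearMap.ext fun p => ?_⟩
  have := LinearMap.congr_fun (congrArg ModuleCat.Hom.hom hy) (e p)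
  simpa using this

theorem isZero_of_fpStalks (hR : IsRightPureSemisimple R)
    (C : CochainComplex (ModuleCat.{u} Rᵐᵒᵖ) ℤ)
    (hC : ∀ Y ∈ fpStalks Rᵐᵒᵖ, ∀ f : Y ⟶ (HomotopyCategory.quotient _ _).obj C, f = 0) :
    IsZero ((HomotopyCategory.quotient _ _).obj C) := by
  have hex (i j k : ℤ) (hij : i + 1 = j) (hjk : j + 1 = k) :
      LinearMap.range (C.d i j).hom = LinearMap.ker (C.d j k).hom := by
    refine le_antisymm ?_ fun z hz => ?_
    · rintro _ ⟨x, rfl⟩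
      exact LinearMap.congr_fun (congrArg ModuleCat.Hom.hom (C.d_comp_d i j k)) x
    · obtain ⟨y, hy⟩ := exists_comp_d_eq_of_fpStalks C hC Rᵐᵒᵖ inferInstance hij hjk
        (LinearMap.toSpanSingleton Rᵐᵒᵖ _ z) (by ext; simpa using hz)
      exact ⟨y 1, by simpa using LinearMap.congr_fun hy 1⟩
  have hr (i j : ℤ) (hij : i + 1 = j) := hR _ _ _ (isPureMono_ker_subtype (C.d i j).hom
    fun P _ _ hP h hh => exists_comp_d_eq_of_fpStalks C hC P hP hij rfl h
      (LinearMap.range_le_ker_iff.1 (hh.trans (hex i j _ hij rfl).le)))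
  choose r hr using hr
  rw [HomotopyCategory.isZero_quotient_obj_iff]
  exact nonempty_homotopy_id_zero C hex r hr

theorem generatesWell_fpStalks (hR : IsRightPureSemisimple R) :
    GeneratesWell (HomotopyCategory (ModuleCat.{u} Rᵐᵒᵖ) (ComplexShape.up ℤ)) Set.univ
      Cardinal.aleph0 (fpStalks Rᵐᵒᵖ) := by
  have hc : ∀ Y ∈ fpStalks Rᵐᵒᵖ, IsCompactObj Y := by
    rintro _ ⟨p, rfl⟩
    exact isCompactObj_quotient_single _ _
  refine ⟨Set.subset_univ _, ?_, fun X _ hX => ?_, fun Y hY => ?_, fun Y hY => ?_⟩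
  · exact small_range _
  · obtain ⟨C, rfl⟩ := X.quotient_obj_surjective
    exact isZero_of_fpStalks hR C hX
  · exact IsCompactObj.isKappaSmall (hc Y hY) exists_isColimit_cofan _
  · exact IsCompactObj.factorsThroughFamily (hc Y hY) exists_isColimit_cofan _ hY

end

end LocWellGen

namespace LocWellGen

open CategoryTheory

universe u

theorem isRightPureSemisimple_of_isWellGenerated (R : Type u) [Ring R]
    (h : IsWellGenerated (HomotopyCategory (ModuleCat.{u} Rᵐᵒᵖ) (ComplexShape.up ℤ))) :
    IsRightPureSemisimple R := by
  obtain ⟨U, hU⟩ := exists_factorsThroughAdd_id Rᵐᵒᵖ h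
  refine IsAddGenerator.isRightPureSemisimple (U := U) fun M _ _ => ?_
  obtain ⟨I, a, b, hab⟩ := hU (ModuleCat.of _ M)
  exact ⟨I, a.hom, b.hom, congrArg ModuleCat.Hom.hom hab⟩

theorem isCompactlyGeneratedSubcat_of_isRightPureSemisimple {R : Type u} [Ring R]
    (hR : IsRightPureSemisimple R) :
    IsCompactlyGeneratedSubcat
      (HomotopyCategory (ModuleCat.{u} Rᵐᵒᵖ) (ComplexShape.up ℤ)) Set.univ :=
  ⟨Cardinal.isRegular_aleph0, _, generatesWell_fpStalks hR⟩

end LocWellGen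

namespace LocWellGen

open CategoryTheory CategoryTheory.Limits

universe u

/-- for a ring `R`, the homotopy category `K(Mod-R)` of complexes of right
`R`-modules is well generated iff it is compactly generated iff `R` is right pure
semisimple. -/
theorem homotopyCategory_wellGenerated_iff_pure_semisimple (R : Type u) [Ring R] :
    (IsWellGenerated (HomotopyCategory (ModuleCat.{u} Rᵐᵒᵖ) (ComplexShape.up ℤ)) ↔
      IsCompactlyGeneratedSubcat
        (HomotopyCategory (ModuleCat.{u} Rᵐᵒᵖ) (ComplexShape.up ℤ)) Set.univ) ∧
    (IsWellGenerated (HomotopyCategory (ModuleCat.{u} Rᵐᵒᵖ) (ComplexShape.up ℤ)) ↔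
      IsRightPureSemisimple R) := by
  have h₁ := isRightPureSemisimple_of_isWellGenerated R
  have h₂ := isCompactlyGeneratedSubcat_of_isRightPureSemisimple (R := R)
  exact ⟨⟨fun h => h₂ (h₁ h), fun h => ⟨_, h⟩⟩, h₁, fun h => ⟨_, h₂ h⟩⟩

end LocWellGen
end
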